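/- arXiv:2207.10624 — 6 statements merged into one kernel-verified Lean document; each statement's English description precedes it below -/
import Mathlib

section
/- Let φ be a flow on ℝ^m reversed by a continuous involution R, and let γ = {φ(t,q) : t ∈ ℝ} be a periodic orbit of minimal period T > 0 (i.e. φ(T,q) = q and φ(t,q) ≠ q for 0 < t < T) that passes through a point q ∈ Fix R. Then γ ∩ Fix R = {q, φ(T/2, q)}, and these two points are distinct; in particular, a symmetric periodic orbit through Fix R intersects Fix R in exactly two points. -/
/-- Let `φ` be a flow on `ℝ^m` reversed by a continuous involution `R`,
and let `γ = {φ t q : t ∈ ℝ}` be a periodic orbit of minimal period `T > 0` passing through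
a point `q ∈ Fix R`.  Then `γ ∩ Fix R = {q, φ (T/2) q}` and these two points are distinct:
a symmetric periodic orbit through `Fix R` meets `Fix R` in exactly two points. -/
theorem symmetric_periodic_orbit_meets_fix_twice {m : ℕ}
    (φ : ℝ → (Fin m → ℝ) → (Fin m → ℝ)) (R : (Fin m → ℝ) → (Fin m → ℝ))
    (hφcont : Continuous (fun p : ℝ × (Fin m → ℝ) => φ p.1 p.2))
    (hφ0 : ∀ x, φ 0 x = x)
    (hφadd : ∀ t s x, φ (t + s) x = φ t (φ s x))
    (hRcont : Continuous R)
    (hinv : ∀ x, R (R x) = x)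
    (hrev : ∀ t x, R (φ t x) = φ (-t) (R x))
    (q : Fin m → ℝ) (hq : R q = q)
    (T : ℝ) (hT : 0 < T) (hper : φ T q = q)
    (hmin : ∀ t : ℝ, 0 < t → t < T → φ t q ≠ q) :
    (Set.range fun t => φ t q) ∩ {x | R x = x} = {q, φ (T / 2) q} ∧
      φ (T / 2) q ≠ q := by
  have hperiodic : Function.Periodic (fun t => φ t q) T := fun t => by
    simp only [hφadd, hper]
  have hfix : ∀ t, R (φ t q) = φ t q ↔ φ (2 * t) q = q := fun t => by
    rw [hrev, hq]
    constructor
    · intro h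
      rw [two_mul, hφadd, ← h, ← hφadd, add_neg_cancel, hφ0]
    · intro h
      calc φ (-t) q = φ (-t) (φ (2 * t) q) := by rw [h]
        _ = φ t q := by rw [← hφadd]; congr 1; ring
  refine ⟨?_, hmin _ (by linarith) (by linarith)⟩
  ext x
  constructor
  · rintro ⟨⟨s, rfl⟩, hx⟩
    obtain ⟨t, ⟨ht0, htT⟩, hst⟩ := hperiodic.exists_mem_Ico₀ hT s
    simp only [Set.mem_ofPred_eq] at hx hst ⊢
    rw [hst] at hx ⊢
    have h2t := (hfix t).1 hx
    rcases ht0.eq_or_lt with rfl | ht0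
    · exact Or.inl (hφ0 q)
    rcases lt_trichotomy (2 * t) T with hlt | heq | hgt
    · exact absurd h2t (hmin _ (by linarith) hlt)
    · right
      rw [Set.mem_singleton_iff, ← heq, mul_div_cancel_left₀ t two_ne_zero]
    · exact absurd ((hperiodic.sub_eq (2 * t)).trans h2t)
        (hmin _ (by linarith) (by linarith))
  · rintro (rfl | rfl)
    · exact ⟨⟨0, hφ0 _⟩, hq⟩
    · refine ⟨⟨T / 2, rfl⟩, (hfix _).2 ?_⟩
      rw [mul_div_cancel₀ T two_ne_zero, hper]
end

section
/- Let R : ℝ^m → ℝ^m be a C¹ involution (R ∘ R = id) with R(0) = 0, and let A = DR(0) be its derivative at the origin. Then: (i) A ∘ A = id; (ii) the map h(u) := (1/2)(u + A(R(u))) satisfies h(R(u)) = A(h(u)) for all u ∈ ℝ^m, i.e. h conjugates R to its linearization A; (iii) Dh(0) = id, so h is a C¹ diffeomorphism of a neighbourhood of 0 onto a neighbourhood of 0. -/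
/-- A `C¹` map of a Banach space whose derivative at a fixed point is the identity restricts to a
`C¹` diffeomorphism between neighbourhoods of that point. -/
theorem exists_openPartialHomeomorph_contDiffOn {E : Type*} [NormedAddCommGroup E]
    [NormedSpace ℝ E] [CompleteSpace E] {h : E → E} {a : E} (hh : ContDiff ℝ 1 h) (ha : h a = a)
    (hd : HasFDerivAt h (ContinuousLinearMap.id ℝ E) a) :
    ∃ F : OpenPartialHomeomorph E E, (F : E → E) = h ∧ a ∈ F.source ∧ a ∈ F.target ∧
      ContDiffOn ℝ 1 F F.source ∧ ContDiffOn ℝ 1 F.symm F.target := by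
  have hd' : HasFDerivAt h ((ContinuousLinearEquiv.refl ℝ E : E ≃L[ℝ] E) : E →L[ℝ] E) a := hd
  have h1 : (1 : WithTop ℕ∞) ≠ ((⊤ : ℕ∞) : WithTop ℕ∞) := by decide
  let G := hh.contDiffAt.toOpenPartialHomeomorph h hd' one_ne_zero
  have hGa : a ∈ G.source := hh.contDiffAt.mem_toOpenPartialHomeomorph_source hd' one_ne_zero
  have hG : (G : E → E) = h := rfl
  have hsymm : ContDiffAt ℝ 1 G.symm (G a) := by
    refine G.contDiffAt_symm (f₀' := ContinuousLinearEquiv.refl ℝ E) (G.map_source hGa) ?_ ?_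
    · rw [G.left_inv hGa]; exact hd'
    · rw [G.left_inv hGa]; exact hh.contDiffAt
  have hs : a ∈ (G.restrContDiff ℝ 1 h1).source := ⟨hGa, hh.contDiffAt, hsymm⟩
  refine ⟨G.restrContDiff ℝ 1 h1, hG, hs, ?_, G.contDiffOn_restrContDiff_source ℝ h1,
    G.contDiffOn_restrContDiff_target ℝ h1⟩
  have := (G.restrContDiff ℝ 1 h1).map_source hs
  rwa [show (G.restrContDiff ℝ 1 h1) a = a from ha] at this

/-- The derivative of an involution at a fixed point is an involution. -/
theorem fderiv_fderiv_apply_of_involutive {E : Type*} [NormedAddCommGroup E] [NormedSpace ℝ E]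
    {R : E → E} {a : E} (hR : DifferentiableAt ℝ R a) (hinv : Function.Involutive R)
    (ha : R a = a) (v : E) : fderiv ℝ R a (fderiv ℝ R a v) = v := by
  have h1 : HasFDerivAt R (fderiv ℝ R a) (R a) := ha.symm ▸ hR.hasFDerivAt
  have h2 := h1.comp a hR.hasFDerivAt
  rw [hinv.comp_self] at h2
  exact DFunLike.congr_fun (h2.unique (hasFDerivAt_id a)) v

/-- Let `R` be a `C¹` involution of `ℝ^m` fixing `0`, and let
`A = DR(0)`.  Then (i) `A ∘ A = id`; (ii) the map `h u = (1/2)(u + A (R u))`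
conjugates `R` to its linearization `A`: `h (R u) = A (h u)`; (iii) `Dh(0) = id`,
so `h` is a `C¹` diffeomorphism of a neighbourhood of `0` onto a neighbourhood of `0`. -/
theorem involution_local_linearization {m : ℕ}
    (R : (Fin m → ℝ) → (Fin m → ℝ))
    (hR : ContDiff ℝ 1 R)
    (hinv : ∀ u, R (R u) = u)
    (hR0 : R 0 = 0) :
    let A : (Fin m → ℝ) →L[ℝ] (Fin m → ℝ) := fderiv ℝ R 0
    let h : (Fin m → ℝ) → (Fin m → ℝ) := fun u => (1 / 2 : ℝ) • (u + A (R u))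
    (∀ v, A (A v) = v) ∧
    (∀ u, h (R u) = A (h u)) ∧
    fderiv ℝ h 0 = ContinuousLinearMap.id ℝ (Fin m → ℝ) ∧
    ∃ F : PartialHomeomorph (Fin m → ℝ) (Fin m → ℝ),
      (∀ u ∈ F.source, F u = h u) ∧ F.source ∈ nhds (0 : Fin m → ℝ) ∧
        F.target ∈ nhds (0 : Fin m → ℝ) ∧
        ContDiffOn ℝ 1 F F.source ∧ ContDiffOn ℝ 1 F.symm F.target := by
  intro A h
  have hA : ∀ v, A (A v) = v :=
    fderiv_fderiv_apply_of_involutive (hR.differentiable one_ne_zero 0) hinv hR0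
  have hd : HasFDerivAt h (ContinuousLinearMap.id ℝ (Fin m → ℝ)) 0 := by
    have hRd : HasFDerivAt R A 0 := (hR.differentiable one_ne_zero 0).hasFDerivAt
    refine (((hasFDerivAt_id 0).add (A.hasFDerivAt.comp 0 hRd)).const_smul
      (1 / 2 : ℝ)).congr_fderiv ?_
    ext1 v
    simp only [smul_apply, add_apply,
      ContinuousLinearMap.comp_apply, ContinuousLinearMap.id_apply, hA]
    module
  have hh : ContDiff ℝ 1 h := (contDiff_id.add (A.contDiff.comp hR)).const_smul (1 / 2 : ℝ)
  have h0 : h 0 = 0 := by simp [h, hR0]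
  refine ⟨hA, fun u => ?_, hd.fderiv, ?_⟩
  · simp only [h, hinv, map_smul, map_add, hA, add_comm]
  · obtain ⟨F, hF, hs, ht, hFs, hFt⟩ := exists_openPartialHomeomorph_contDiffOn hh h0 hd
    exact ⟨F.toPartialHomeomorph, fun u _ => congrFun hF u, F.open_source.mem_nhds hs,
      F.open_target.mem_nhds ht, hFs, hFt⟩
end

section
/- Under the stated hypotheses, there exist a neighbourhood U' ⊂ U of the segment {(0,0,z) : |z| ≤ c}, a smooth family z ↦ A(z) of invertible (n−1)×(n−1) matrices, and a constant C > 0, such that for all (x,y,z) ∈ U' the map Π has the form Π(x,y,z) = (A(z)x + e(x,y,z), A(z)^{-1}y + f(x,y,z), z + g(x,y,z)), where the smooth remainder terms satisfy ‖e(x,y,z)‖ ≤ C(‖x‖² + ‖x‖·‖y‖), ‖f(x,y,z)‖ ≤ C(‖y‖² + ‖x‖·‖y‖), and |g(x,y,z)| ≤ C‖x‖·‖y‖. In particular, reversibility forces the linear part in the y-variable to be the inverse A(z)^{-1} of the linear part A(z) in the x-variable. -/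
section ProductDerivatives

variable {E : Type*} [NormedAddCommGroup E] [NormedSpace ℝ E]

/-- A map vanishing at the origin whose derivative is within `K` of `L` on the closed ball of radius
`‖x‖` differs from `L` by at most `K * ‖x‖` at `x`. -/
theorem norm_sub_apply_le_of_hasFDerivAt {F : Type*} [NormedAddCommGroup F] [NormedSpace ℝ F]
    {g : E → F} {g' : E → E →L[ℝ] F} {L : E →L[ℝ] F} {K : ℝ} {x : E} (h0 : g 0 = 0)
    (hg : ∀ ξ, ‖ξ‖ ≤ ‖x‖ → HasFDerivAt g (g' ξ) ξ)
    (hK : ∀ ξ, ‖ξ‖ ≤ ‖x‖ → ‖g' ξ - L‖ ≤ K) : ‖g x - L x‖ ≤ K * ‖x‖ := by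
  have := (convex_closedBall (0 : E) ‖x‖).norm_image_sub_le_of_norm_hasFDerivWithin_le'
    (f := g) (f' := g') (φ := L) (C := K) (x := 0) (y := x)
    (fun ξ hξ => (hg ξ (by simpa using hξ)).hasFDerivWithinAt)
    (fun ξ hξ => hK ξ (by simpa using hξ)) (by simp) (by simp)
  simpa [h0] using this

theorem hasFDerivAt_prodMk_zero_left (y : E) (z : ℝ) (ξ : E) :
    HasFDerivAt (fun ξ : E => (ξ, y, z)) (ContinuousLinearMap.inl ℝ E (E × ℝ)) ξ :=
  hasFDerivAt_prodMk_left ξ (y, z)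

theorem hasFDerivAt_prodMk_mid (x : E) (z : ℝ) (ξ : E) :
    HasFDerivAt (fun ξ : E => (x, ξ, z))
      ((ContinuousLinearMap.inr ℝ E (E × ℝ)).comp (ContinuousLinearMap.inl ℝ E ℝ)) ξ :=
  (hasFDerivAt_prodMk_right x (ξ, z)).comp ξ (hasFDerivAt_prodMk_left ξ z)

theorem norm_comp_inl_le {F : Type*} [NormedAddCommGroup F] [NormedSpace ℝ F]
    (T : E × E × ℝ →L[ℝ] F) : ‖T.comp (ContinuousLinearMap.inl ℝ E (E × ℝ))‖ ≤ ‖T‖ := by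
  refine ContinuousLinearMap.opNorm_le_bound _ (norm_nonneg _) fun u => ?_
  exact (T.le_opNorm (u, 0, 0)).trans_eq (by simp [Prod.norm_def])

theorem norm_comp_mid_le {F : Type*} [NormedAddCommGroup F] [NormedSpace ℝ F]
    (T : E × E × ℝ →L[ℝ] F) :
    ‖T.comp ((ContinuousLinearMap.inr ℝ E (E × ℝ)).comp (ContinuousLinearMap.inl ℝ E ℝ))‖
      ≤ ‖T‖ := by
  refine ContinuousLinearMap.opNorm_le_bound _ (norm_nonneg _) fun u => ?_
  simpa [Prod.norm_def] using T.le_opNorm (0, u, 0)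

theorem norm_fst_comp_le {F G H : Type*} [NormedAddCommGroup F] [NormedSpace ℝ F]
    [NormedAddCommGroup G] [NormedSpace ℝ G] [NormedAddCommGroup H] [NormedSpace ℝ H]
    (T : H →L[ℝ] F × G) : ‖(ContinuousLinearMap.fst ℝ F G).comp T‖ ≤ ‖T‖ :=
  ContinuousLinearMap.opNorm_le_bound _ (norm_nonneg _) fun u =>
    (norm_fst_le (T u)).trans (T.le_opNorm u)

theorem norm_snd_comp_le {F G H : Type*} [NormedAddCommGroup F] [NormedSpace ℝ F]
    [NormedAddCommGroup G] [NormedSpace ℝ G] [NormedAddCommGroup H] [NormedSpace ℝ H]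
    (T : H →L[ℝ] F × G) : ‖(ContinuousLinearMap.snd ℝ F G).comp T‖ ≤ ‖T‖ :=
  ContinuousLinearMap.opNorm_le_bound _ (norm_nonneg _) fun u =>
    (norm_snd_le (T u)).trans (T.le_opNorm u)

/-- The derivative in the first variable, along an invariant fibre `{y = 0, z = z₀}`, has no
components in the other two variables. -/
theorem snd_hasFDerivAt_apply_eq_zero {P : E × E × ℝ → E × E × ℝ}
    {D : E × E × ℝ →L[ℝ] E × E × ℝ} {U : Set (E × E × ℝ)} (hU : IsOpen U)
    (hstable : ∀ p ∈ U, p.2.1 = 0 → (P p).2.1 = 0 ∧ (P p).2.2 = p.2.2) {x : E} {z : ℝ}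
    (hp : (x, 0, z) ∈ U) (hD : HasFDerivAt P D (x, 0, z)) (u : E) : (D (u, 0, 0)).2 = 0 := by
  have h1 := (hD.comp x (hasFDerivAt_prodMk_zero_left 0 z x)).snd
  have hcont : ContinuousAt (fun ξ : E => (ξ, (0 : E), z)) x := by fun_prop
  have h2 : (fun ξ : E => ((P ∘ fun ξ : E => (ξ, (0 : E), z)) ξ).2) =ᶠ[nhds x]
      fun _ => ((0 : E), z) := by
    filter_upwards [hcont.preimage_mem_nhds (hU.mem_nhds hp)] with ξ hξ
    exact Prod.ext (hstable _ hξ rfl).1 (hstable _ hξ rfl).2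
  have h3 := h1.unique ((hasFDerivAt_const ((0 : E), z) x).congr_of_eventuallyEq h2)
  exact DFunLike.congr_fun h3 u

/-- The derivative in the second variable, along an invariant fibre `{x = 0, z = z₀}`, has no
components in the other two variables. -/
theorem fst_hasFDerivAt_apply_eq_zero {P : E × E × ℝ → E × E × ℝ}
    {D : E × E × ℝ →L[ℝ] E × E × ℝ} {U : Set (E × E × ℝ)} (hU : IsOpen U)
    (hunstable : ∀ p ∈ U, p.1 = 0 → (P p).1 = 0 ∧ (P p).2.2 = p.2.2) {y : E} {z : ℝ}
    (hp : (0, y, z) ∈ U) (hD : HasFDerivAt P D (0, y, z)) (v : E) :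
    (D (0, v, 0)).1 = 0 ∧ (D (0, v, 0)).2.2 = 0 := by
  have h1 := hD.comp y (hasFDerivAt_prodMk_mid 0 z y)
  have hcont : ContinuousAt (fun ξ : E => ((0 : E), ξ, z)) y := by fun_prop
  have hmem := hcont.preimage_mem_nhds (hU.mem_nhds hp)
  have h2 : (fun ξ : E => ((P ∘ fun ξ : E => ((0 : E), ξ, z)) ξ).1) =ᶠ[nhds y]
      fun _ => (0 : E) := by
    filter_upwards [hmem] with ξ hξ using (hunstable _ hξ rfl).1
  have h3 : (fun ξ : E => ((P ∘ fun ξ : E => ((0 : E), ξ, z)) ξ).2.2) =ᶠ[nhds y]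
      fun _ => z := by
    filter_upwards [hmem] with ξ hξ using (hunstable _ hξ rfl).2
  have h4 := h1.fst.unique ((hasFDerivAt_const (0 : E) y).congr_of_eventuallyEq h2)
  have h5 := h1.snd.snd.unique ((hasFDerivAt_const z y).congr_of_eventuallyEq h3)
  exact ⟨by simpa using DFunLike.congr_fun h4 v, by simpa using DFunLike.congr_fun h5 v⟩

/-- At a symmetric fixed point the derivative of a reversible map is reversible. -/
theorem hasFDerivAt_reversible {P : E × E × ℝ → E × E × ℝ}
    {D : E × E × ℝ →L[ℝ] E × E × ℝ} {U : Set (E × E × ℝ)} (hU : IsOpen U)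
    (hrev : ∀ p ∈ U, ((P p).2.1, (P p).1, (P p).2.2) ∈ U →
        P ((P p).2.1, (P p).1, (P p).2.2) = (p.2.1, p.1, p.2.2)) {z : ℝ}
    (hp : (0, 0, z) ∈ U) (hfix : P (0, 0, z) = (0, 0, z)) (hD : HasFDerivAt P D (0, 0, z))
    (w : E × E × ℝ) :
    D ((D w).2.1, (D w).1, (D w).2.2) = (w.2.1, w.1, w.2.2) := by
  have hid := hasFDerivAt_id (𝕜 := ℝ) ((0 : E), (0 : E), z)
  have hR := hid.snd.fst.prodMk (hid.fst.prodMk hid.snd.snd)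
  have hRP := hD.snd.fst.prodMk (hD.fst.prodMk hD.snd.snd)
  have hPRP := HasFDerivAt.comp (g := P) (g' := D) ((0 : E), (0 : E), z)
    (by simpa [hfix] using hD) hRP
  have hmem := hRP.continuousAt.preimage_mem_nhds
    (hU.mem_nhds (by simpa [hfix] using hp))
  have heq : (P ∘ fun p => ((P p).2.1, (P p).1, (P p).2.2)) =ᶠ[nhds ((0 : E), (0 : E), z)]
      fun p => (p.2.1, p.1, p.2.2) := by
    filter_upwards [hmem, hU.mem_nhds hp] with p h1 h2 using hrev p h2 h1
  have h := (hPRP.congr_of_eventuallyEq heq.symm).unique hR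
  simpa using DFunLike.congr_fun h w

end ProductDerivatives

/-- A smooth map of the line into a bounded interval, equal to the identity on a smaller one. -/
theorem exists_contDiff_eqOn_id_bounded {a b : ℝ} (ha : 0 < a) (hab : a < b) :
    ∃ φ : ℝ → ℝ, ContDiff ℝ (⊤ : ℕ∞) φ ∧ (∀ z, |z| ≤ a → φ z = z) ∧ ∀ z, |φ z| ≤ b := by
  let χ : ContDiffBump (0 : ℝ) := ⟨a, b, ha, hab⟩
  refine ⟨fun z => χ z * z, χ.contDiff.mul contDiff_id, fun z hz => ?_, fun z => ?_⟩
  · change χ z * z = z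
    rw [χ.one_of_mem_closedBall (by simpa using hz), one_mul]
  · rw [abs_mul, abs_of_nonneg χ.nonneg]
    by_cases hz : |z| ≤ b
    · exact (mul_le_of_le_one_left (abs_nonneg z) χ.le_one).trans hz
    · rw [χ.zero_of_le_dist (by simpa [χ] using (not_le.1 hz).le), zero_mul]
      exact (ha.trans hab).le

/-- A neighbourhood of the segment `{(0, 0, z) : |z| ≤ c}` contains a closed box around it. -/
theorem exists_box_subset {E : Type*} [NormedAddCommGroup E] {U : Set (E × E × ℝ)}
    (hU : IsOpen U) {c : ℝ}
    (hseg : {p : E × E × ℝ | p.1 = 0 ∧ p.2.1 = 0 ∧ |p.2.2| ≤ c} ⊆ U) (hc : 0 < c) :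
    ∃ δ > 0, Metric.closedBall (0 : E) δ ×ˢ Metric.closedBall (0 : E) δ ×ˢ
      Metric.closedBall (0 : ℝ) (c + δ) ⊆ U := by
  have hK : IsCompact ((fun z : ℝ => ((0 : E), (0 : E), z)) '' Metric.closedBall 0 c) :=
    (isCompact_closedBall 0 c).image (by fun_prop)
  have hKU : ((fun z : ℝ => ((0 : E), (0 : E), z)) '' Metric.closedBall 0 c) ⊆ U := by
    rintro _ ⟨z, hz, rfl⟩
    exact hseg ⟨rfl, rfl, by simpa using hz⟩
  obtain ⟨δ, hδ, hsub⟩ := hK.exists_cthickening_subset_open hU hKU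
  refine ⟨δ, hδ, fun p hp => hsub ?_⟩
  obtain ⟨x, y, z⟩ := p
  simp only [Set.mem_prod, mem_closedBall_zero_iff, Real.norm_eq_abs] at hp
  obtain ⟨hx, hy, hz⟩ := hp
  obtain ⟨hz1, hz2⟩ := abs_le.1 hz
  have hw : |max (-c) (min c z)| ≤ c :=
    abs_le.2 ⟨le_max_left _ _, max_le (by linarith) (min_le_left _ _)⟩
  refine Metric.mem_cthickening_of_dist_le _ (0, 0, max (-c) (min c z)) _ _
    ⟨_, by simpa using hw, rfl⟩ ?_
  simp only [Prod.dist_eq, dist_zero_right, Real.dist_eq]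
  refine max_le hx (max_le hy (abs_le.2 ?_))
  rcases max_choice (-c) (min c z) with h | h <;> rcases min_choice c z with h' | h' <;>
    constructor <;> grind

/-- The normal form near a curve of symmetric fixed points, over any finite-dimensional normed space;
the fixed points and the local invertibility come from the other hypotheses. -/
theorem exists_normal_form_of_reversible {E : Type*}
    [NormedAddCommGroup E] [NormedSpace ℝ E] [FiniteDimensional ℝ E] (c : ℝ) (hc : 0 < c)
    (U : Set (E × E × ℝ)) (hUopen : IsOpen U)
    (hseg : {p : E × E × ℝ | p.1 = 0 ∧ p.2.1 = 0 ∧ |p.2.2| ≤ c} ⊆ U)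
    (Pi : E × E × ℝ → E × E × ℝ)
    (hsmooth : ContDiffOn ℝ (⊤ : ℕ∞) Pi U)
    (hstable : ∀ p ∈ U, p.2.1 = 0 → (Pi p).2.1 = 0 ∧ (Pi p).2.2 = p.2.2)
    (hunstable : ∀ p ∈ U, p.1 = 0 → (Pi p).1 = 0 ∧ (Pi p).2.2 = p.2.2)
    (hrev : ∀ p ∈ U, ((Pi p).2.1, (Pi p).1, (Pi p).2.2) ∈ U →
        Pi ((Pi p).2.1, (Pi p).1, (Pi p).2.2) = (p.2.1, p.1, p.2.2)) :
    ∃ (U' : Set (E × E × ℝ)) (A Ainv : ℝ → (E →L[ℝ] E)) (C : ℝ),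
      IsOpen U' ∧ U' ⊆ U ∧
      {p : E × E × ℝ | p.1 = 0 ∧ p.2.1 = 0 ∧ |p.2.2| ≤ c} ⊆ U' ∧
      ContDiff ℝ (⊤ : ℕ∞) A ∧ ContDiff ℝ (⊤ : ℕ∞) Ainv ∧
      (∀ z : ℝ, (A z).comp (Ainv z) = ContinuousLinearMap.id ℝ _ ∧
        (Ainv z).comp (A z) = ContinuousLinearMap.id ℝ _) ∧
      0 < C ∧
      ∀ p ∈ U',
        ‖(Pi p).1 - A p.2.2 p.1‖ ≤ C * (‖p.1‖ ^ 2 + ‖p.1‖ * ‖p.2.1‖) ∧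
        ‖(Pi p).2.1 - Ainv p.2.2 p.2.1‖ ≤ C * (‖p.2.1‖ ^ 2 + ‖p.1‖ * ‖p.2.1‖) ∧
        |(Pi p).2.2 - p.2.2| ≤ C * (‖p.1‖ * ‖p.2.1‖) := by
  obtain ⟨δ, hδ, hVU⟩ := exists_box_subset hUopen hseg hc
  set V : Set (E × E × ℝ) := Metric.closedBall (0 : E) δ ×ˢ Metric.closedBall (0 : E) δ ×ˢ
      Metric.closedBall (0 : ℝ) (c + δ) with hV
  have hmemV : ∀ x y z, ‖x‖ ≤ δ → ‖y‖ ≤ δ → |z| ≤ c + δ → ((x, y, z) : E × E × ℝ) ∈ V := by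
    intro x y z hx hy hz
    simpa [hV] using ⟨hx, hy, hz⟩
  have hVconv : Convex ℝ V :=
    (convex_closedBall _ _).prod ((convex_closedBall _ _).prod (convex_closedBall _ _))
  have hVcomp : IsCompact V :=
    (isCompact_closedBall _ _).prod ((isCompact_closedBall _ _).prod (isCompact_closedBall _ _))
  have hdiff : ∀ p ∈ U, HasFDerivAt Pi (fderiv ℝ Pi p) p := fun p hp =>
    ((hsmooth.contDiffAt (hUopen.mem_nhds hp)).differentiableAt (by simp)).hasFDerivAt
  have hD : ContDiffOn ℝ (⊤ : ℕ∞) (fderiv ℝ Pi) U :=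
    hsmooth.fderiv_of_isOpen hUopen (by simp)
  obtain ⟨K, hKV⟩ : ∃ K, LipschitzOnWith K (fderiv ℝ Pi) V :=
    (hD.mono hVU).exists_lipschitzOnWith (by simp) hVconv hVcomp
  have hlip : ∀ p ∈ V, ∀ q ∈ V, ‖fderiv ℝ Pi p - fderiv ℝ Pi q‖ ≤ K * ‖p - q‖ :=
    fun p hp q hq => by simpa [dist_eq_norm] using hKV.dist_le_mul p hp q hq
  obtain ⟨φ, hφ, hφid, hφb⟩ := exists_contDiff_eqOn_id_bounded
    (a := c + δ / 2) (b := c + δ) (by positivity) (by linarith)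
  have hφV : ∀ z, ((0, 0, φ z) : E × E × ℝ) ∈ V := fun z =>
    hmemV 0 0 (φ z) (by simpa using hδ.le) (by simpa using hδ.le) (hφb z)
  have hDφ : ContDiff ℝ (⊤ : ℕ∞) fun z => fderiv ℝ Pi (0, 0, φ z) :=
    hD.comp_contDiff (contDiff_const.prodMk (contDiff_const.prodMk hφ)) fun z => hVU (hφV z)
  let i₁ := ContinuousLinearMap.inl ℝ E (E × ℝ)
  let i₂ := (ContinuousLinearMap.inr ℝ E (E × ℝ)).comp (ContinuousLinearMap.inl ℝ E ℝ)
  let π₁ := ContinuousLinearMap.fst ℝ E (E × ℝ)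
  let π₂ := ContinuousLinearMap.snd ℝ E (E × ℝ)
  refine ⟨Metric.ball 0 δ ×ˢ Metric.ball 0 δ ×ˢ Metric.ball 0 (c + δ / 2),
    fun z => π₁.comp ((fderiv ℝ Pi (0, 0, φ z)).comp i₁),
    fun z => (ContinuousLinearMap.fst ℝ E ℝ).comp (π₂.comp ((fderiv ℝ Pi (0, 0, φ z)).comp i₂)),
    K + 1, Metric.isOpen_ball.prod (Metric.isOpen_ball.prod Metric.isOpen_ball), ?_, ?_,
    contDiff_const.clm_comp (hDφ.clm_comp contDiff_const),
    contDiff_const.clm_comp (contDiff_const.clm_comp (hDφ.clm_comp contDiff_const)), ?_,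
    by positivity, ?_⟩
  · refine Set.Subset.trans ?_ hVU
    exact Set.prod_mono Metric.ball_subset_closedBall (Set.prod_mono Metric.ball_subset_closedBall
      (Metric.ball_subset_closedBall.trans (Metric.closedBall_subset_closedBall (by linarith))))
  · rintro ⟨x, y, z⟩ ⟨hx, hy, hz⟩
    simp only at hx hy hz
    subst hx hy
    simpa [hδ] using lt_of_le_of_lt hz (by linarith)
  · intro z
    have hq := hVU (hφV z)
    have hfixq : Pi (0, 0, φ z) = (0, 0, φ z) :=
      Prod.ext (hunstable _ hq rfl).1 (Prod.ext (hstable _ hq rfl).1 (hstable _ hq rfl).2)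
    have hr := hasFDerivAt_reversible hUopen hrev hq hfixq (hdiff _ hq)
    have hs := snd_hasFDerivAt_apply_eq_zero hUopen hstable hq (hdiff _ hq)
    have hu := fst_hasFDerivAt_apply_eq_zero hUopen hunstable hq (hdiff _ hq)
    constructor
    · refine ContinuousLinearMap.ext fun v => ?_
      have h := hr (0, v, 0)
      rw [(hu v).1, (hu v).2] at h
      exact congrArg Prod.fst h
    · refine ContinuousLinearMap.ext fun u => ?_
      have h := hr (u, 0, 0)
      rw [hs u] at h
      exact congrArg (fun p => p.2.1) h
  · rintro ⟨x, y, z⟩ ⟨hx, hy, hz⟩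
    simp only [mem_ball_zero_iff, Real.norm_eq_abs] at hx hy hz
    have hzV : |z| ≤ c + δ := by linarith
    have h0 : ‖(0 : E)‖ ≤ δ := by simpa using hδ.le
    have hq : ((0, 0, z) : E × E × ℝ) ∈ V := hmemV _ _ _ h0 h0 hzV
    have hxV : ∀ ξ : E, ‖ξ‖ ≤ ‖x‖ → ∀ η : E, ‖η‖ ≤ ‖y‖ → (ξ, η, z) ∈ V := fun ξ hξ η hη =>
      hmemV _ _ _ (hξ.trans hx.le) (hη.trans hy.le) hzV
    have hK : (0 : ℝ) ≤ K := K.2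
    have hnear : ∀ ξ : E, ‖ξ‖ ≤ ‖x‖ → ∀ η : E, ‖η‖ ≤ ‖y‖ →
        ‖fderiv ℝ Pi (ξ, η, z) - fderiv ℝ Pi (0, 0, z)‖ ≤ K * (‖x‖ + ‖y‖) := by
      intro ξ hξ η hη
      refine (hlip _ (hxV ξ hξ η hη) _ hq).trans (mul_le_mul_of_nonneg_left ?_ hK)
      simp only [Prod.mk_sub_mk, sub_zero, sub_self, Prod.norm_def, norm_zero]
      exact max_le (by linarith [norm_nonneg y])
        (max_le (by linarith [norm_nonneg x]) (by positivity))
    simp only [hφid z hz.le]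
    refine ⟨?_, ?_, ?_⟩
    · have h := norm_sub_apply_le_of_hasFDerivAt (g := fun ξ => (Pi (ξ, y, z)).1)
        (g' := fun ξ => π₁.comp ((fderiv ℝ Pi (ξ, y, z)).comp i₁))
        (L := π₁.comp ((fderiv ℝ Pi (0, 0, z)).comp i₁)) (K := K * (‖x‖ + ‖y‖)) (x := x)
        (hunstable _ (hVU (hxV 0 (by simp) y le_rfl)) rfl).1
        (fun ξ hξ => ((hdiff _ (hVU (hxV ξ hξ y le_rfl))).comp ξ
          (hasFDerivAt_prodMk_zero_left y z ξ)).fst)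
        (fun ξ hξ => by
          rw [← ContinuousLinearMap.comp_sub, ← ContinuousLinearMap.sub_comp]
          exact (norm_fst_comp_le _).trans ((norm_comp_inl_le _).trans (hnear ξ hξ y le_rfl)))
      refine h.trans ?_
      nlinarith [norm_nonneg x, norm_nonneg y, mul_nonneg (norm_nonneg x) (norm_nonneg y)]
    · have h := norm_sub_apply_le_of_hasFDerivAt (g := fun η => (Pi (x, η, z)).2.1)
        (g' := fun η => (ContinuousLinearMap.fst ℝ E ℝ).comp
          (π₂.comp ((fderiv ℝ Pi (x, η, z)).comp i₂)))
        (L := (ContinuousLinearMap.fst ℝ E ℝ).comp (π₂.comp ((fderiv ℝ Pi (0, 0, z)).comp i₂)))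
        (K := K * (‖x‖ + ‖y‖)) (x := y)
        (hstable _ (hVU (hxV x le_rfl 0 (by simp))) rfl).1
        (fun η hη => ((hdiff _ (hVU (hxV x le_rfl η hη))).comp η
          (hasFDerivAt_prodMk_mid x z η)).snd.fst)
        (fun η hη => by
          rw [← ContinuousLinearMap.comp_sub, ← ContinuousLinearMap.comp_sub,
            ← ContinuousLinearMap.sub_comp]
          exact (norm_fst_comp_le _).trans ((norm_snd_comp_le _).trans
            ((norm_comp_mid_le _).trans (hnear x le_rfl η hη))))
      refine h.trans ?_
      nlinarith [norm_nonneg x, norm_nonneg y, mul_nonneg (norm_nonneg x) (norm_nonneg y)]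
    · have h := norm_sub_apply_le_of_hasFDerivAt (g := fun ξ => (Pi (ξ, y, z)).2.2 - z)
        (g' := fun ξ => (ContinuousLinearMap.snd ℝ E ℝ).comp
          (π₂.comp ((fderiv ℝ Pi (ξ, y, z)).comp i₁)))
        (L := 0) (K := K * ‖y‖) (x := x)
        (sub_eq_zero.2 (hunstable _ (hVU (hxV 0 (by simp) y le_rfl)) rfl).2)
        (fun ξ hξ => ((hdiff _ (hVU (hxV ξ hξ y le_rfl))).comp ξ
          (hasFDerivAt_prodMk_zero_left y z ξ)).snd.snd.sub_const z)
        (fun ξ hξ => by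
          have hξ0 := hxV ξ hξ 0 (by simp)
          have hzero : π₂.comp ((fderiv ℝ Pi (ξ, 0, z)).comp i₁) = 0 :=
            ContinuousLinearMap.ext fun u =>
              snd_hasFDerivAt_apply_eq_zero hUopen hstable (hVU hξ0) (hdiff _ (hVU hξ0)) u
          have hle := hlip _ (hxV ξ hξ y le_rfl) _ hξ0
          rw [sub_zero, ← sub_zero (π₂.comp ((fderiv ℝ Pi (ξ, y, z)).comp i₁)), ← hzero,
            ← ContinuousLinearMap.comp_sub, ← ContinuousLinearMap.sub_comp]
          refine (norm_snd_comp_le _).trans ((norm_snd_comp_le _).trans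
            ((norm_comp_inl_le _).trans (hle.trans_eq ?_)))
          simp [Prod.norm_def])
      have h' : |(Pi (x, y, z)).2.2 - z| ≤ K * ‖y‖ * ‖x‖ := by simpa using h
      refine h'.trans ?_
      nlinarith [mul_nonneg (norm_nonneg x) (norm_nonneg y)]

/-- Normal form near a curve of symmetric fixed points.  Let `Pi` be a
smooth diffeomorphism onto its image, defined near the segment `{(0,0,z) : |z| ≤ c}` in
`ℝ^{n-1} × ℝ^{n-1} × ℝ`, fixing every point `(0,0,z)`, leaving the local stable manifolds
`{y = 0, z = z₀}` and unstable manifolds `{x = 0, z = z₀}` invariant, and reversible with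
respect to `R(x,y,z) = (y,x,z)` (i.e. `R ∘ Pi ∘ R = Pi⁻¹`).  Then, on a smaller
neighbourhood `U'` of the segment, `Pi(x,y,z) = (A(z)x + e, A(z)⁻¹y + f, z + g)` with
`‖e‖ ≤ C(‖x‖² + ‖x‖‖y‖)`, `‖f‖ ≤ C(‖y‖² + ‖x‖‖y‖)` and `|g| ≤ C‖x‖‖y‖`. -/
theorem reversible_normal_form {n : ℕ} (hn : 2 ≤ n) (c : ℝ) (hc : 0 < c)
    (U : Set ((Fin (n - 1) → ℝ) × (Fin (n - 1) → ℝ) × ℝ)) (hUopen : IsOpen U)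
    (hseg : {p : (Fin (n - 1) → ℝ) × (Fin (n - 1) → ℝ) × ℝ |
        p.1 = 0 ∧ p.2.1 = 0 ∧ |p.2.2| ≤ c} ⊆ U)
    (Pi : (Fin (n - 1) → ℝ) × (Fin (n - 1) → ℝ) × ℝ →
        (Fin (n - 1) → ℝ) × (Fin (n - 1) → ℝ) × ℝ)
    (hsmooth : ContDiffOn ℝ (⊤ : ℕ∞) Pi U)
    (hinj : Set.InjOn Pi U)
    (hfix : ∀ z : ℝ, |z| ≤ c → Pi (0, 0, z) = (0, 0, z))
    (hstable : ∀ p ∈ U, p.2.1 = 0 → (Pi p).2.1 = 0 ∧ (Pi p).2.2 = p.2.2)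
    (hunstable : ∀ p ∈ U, p.1 = 0 → (Pi p).1 = 0 ∧ (Pi p).2.2 = p.2.2)
    (hrev : ∀ p ∈ U, ((Pi p).2.1, (Pi p).1, (Pi p).2.2) ∈ U →
        Pi ((Pi p).2.1, (Pi p).1, (Pi p).2.2) = (p.2.1, p.1, p.2.2)) :
    ∃ (U' : Set ((Fin (n - 1) → ℝ) × (Fin (n - 1) → ℝ) × ℝ))
      (A Ainv : ℝ → ((Fin (n - 1) → ℝ) →L[ℝ] (Fin (n - 1) → ℝ))) (C : ℝ),
      IsOpen U' ∧ U' ⊆ U ∧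
      {p : (Fin (n - 1) → ℝ) × (Fin (n - 1) → ℝ) × ℝ |
        p.1 = 0 ∧ p.2.1 = 0 ∧ |p.2.2| ≤ c} ⊆ U' ∧
      ContDiff ℝ (⊤ : ℕ∞) A ∧ ContDiff ℝ (⊤ : ℕ∞) Ainv ∧
      (∀ z : ℝ, (A z).comp (Ainv z) = ContinuousLinearMap.id ℝ _ ∧
        (Ainv z).comp (A z) = ContinuousLinearMap.id ℝ _) ∧
      0 < C ∧
      ∀ p ∈ U',
        ‖(Pi p).1 - A p.2.2 p.1‖ ≤ C * (‖p.1‖ ^ 2 + ‖p.1‖ * ‖p.2.1‖) ∧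
        ‖(Pi p).2.1 - Ainv p.2.2 p.2.1‖ ≤ C * (‖p.2.1‖ ^ 2 + ‖p.1‖ * ‖p.2.1‖) ∧
        |(Pi p).2.2 - p.2.2| ≤ C * (‖p.1‖ * ‖p.2.1‖) := by
  exact exists_normal_form_of_reversible c hc U hUopen hseg Pi hsmooth hstable hunstable hrev
end

section
/- There exists δ > 0 with the following property. Let ψ : J → ℝ be a C¹ diffeomorphism from J = (−1,1) onto its image with d₁(ψ, id) < δ and ψ ≠ id. Then there exist ε ∈ {+1, −1} and real numbers a < b < c < d in J such that, writing χ = ψ if ε = +1 and χ = ψ^{-1} if ε = −1, both χ and χ^{-1} are defined on an open interval containing [a,d] and: (1) χ² is defined on [a,b] and χ²([a,b]) ⊂ (b,c); (2) χ^{-1}([b,c]) ⊂ (a,c); (3) χ^{-2} is defined on [c,d] and χ^{-2}([c,d]) ⊂ (b,c); (4) χ([b,c]) ⊂ (b,d). -/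
/-- If `χ` and `χinv` move every point of an interval of length `16 t` by approximately `t` and
`-t`, then four points of that interval spaced by `3t/2`, `3t`, `3t/2` satisfy the inclusions
of the iterated function system. -/
theorem exists_inclusions_of_approx_translation {χ χinv : ℝ → ℝ} {l t : ℝ} (ht : 0 < t)
    (hχ : ∀ x ∈ Set.Ioo (l + 2 * t) (l + 18 * t), |χ x - x - t| ≤ t / 10)
    (hχinv : ∀ x ∈ Set.Ioo (l + 2 * t) (l + 18 * t), |χinv x - x + t| ≤ t / 10) :
    ∃ a b c d : ℝ, l + 2 * t < a ∧ a < b ∧ b < c ∧ c < d ∧ d < l + 18 * t ∧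
      (∀ x ∈ Set.Icc a b,
        χ x ∈ Set.Ioo (l + 2 * t) (l + 18 * t) ∧ χ (χ x) ∈ Set.Ioo b c) ∧
      (∀ x ∈ Set.Icc b c, χinv x ∈ Set.Ioo a c) ∧
      (∀ x ∈ Set.Icc c d,
        χinv x ∈ Set.Ioo (l + 2 * t) (l + 18 * t) ∧ χinv (χinv x) ∈ Set.Ioo b c) ∧
      (∀ x ∈ Set.Icc b c, χ x ∈ Set.Ioo b d) := by
  simp only [Set.mem_Ioo, Set.mem_Icc, abs_le] at *
  refine ⟨l + 6 * t, l + 15 / 2 * t, l + 21 / 2 * t, l + 12 * t, by linarith, by linarith,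
    by linarith, by linarith, by linarith, ?_, ?_, ?_, ?_⟩
  · rintro x ⟨h₁, h₂⟩
    have h := hχ x ⟨by linarith, by linarith⟩
    have hV : l + 2 * t < χ x ∧ χ x < l + 18 * t := ⟨by linarith, by linarith⟩
    have h' := hχ _ hV
    exact ⟨hV, by linarith, by linarith⟩
  · rintro x ⟨h₁, h₂⟩
    have h := hχinv x ⟨by linarith, by linarith⟩
    exact ⟨by linarith, by linarith⟩
  · rintro x ⟨h₁, h₂⟩
    have h := hχinv x ⟨by linarith, by linarith⟩
    have hV : l + 2 * t < χinv x ∧ χinv x < l + 18 * t := ⟨by linarith, by linarith⟩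
    have h' := hχinv _ hV
    exact ⟨hV, by linarith, by linarith⟩
  · rintro x ⟨h₁, h₂⟩
    have h := hχ x ⟨by linarith, by linarith⟩
    exact ⟨by linarith, by linarith⟩

/-- A continuous map which is approximately the translation by `h` on an interval of length
`20 |h|` takes every value well inside that interval, at a point which is approximately the
translate of the value by `-h`. -/
theorem exists_preimage_of_approx_translation {ψ : ℝ → ℝ} {l h : ℝ}
    (hcont : ContinuousOn ψ (Set.Icc l (l + 20 * |h|)))
    (hψ : ∀ x ∈ Set.Icc l (l + 20 * |h|), |ψ x - x - h| ≤ |h| / 10)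
    {x : ℝ} (hx : x ∈ Set.Ioo (l + 2 * |h|) (l + 18 * |h|)) :
    ∃ y ∈ Set.Icc l (l + 20 * |h|), ψ y = x ∧ |y - x + h| ≤ |h| / 10 := by
  have hle : l ≤ l + 20 * |h| := by linarith [abs_nonneg h]
  have hl := abs_le.1 (hψ l ⟨le_rfl, hle⟩)
  have hr := abs_le.1 (hψ (l + 20 * |h|) ⟨hle, le_rfl⟩)
  obtain ⟨hx₁, hx₂⟩ := hx
  have h₁ := le_abs_self h
  have h₂ := neg_abs_le h
  obtain ⟨y, hy, rfl⟩ := intermediate_value_Icc hle hcont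
    (show x ∈ Set.Icc (ψ l) (ψ (l + 20 * |h|)) from ⟨by linarith, by linarith⟩)
  refine ⟨y, hy, rfl, ?_⟩
  have := hψ y hy
  rwa [← abs_neg, show -(y - ψ y + h) = ψ y - y - h by ring]

/-- A map whose derivative is `δ`-close to `1` has displacement varying at rate at most `δ`. -/
theorem abs_displacement_sub_le {ψ ψ' : ℝ → ℝ} {s : Set ℝ} {δ : ℝ} (hs : Convex ℝ s)
    (hderiv : ∀ u ∈ s, HasDerivAt ψ (ψ' u) u) (hδ : ∀ u ∈ s, |ψ' u - 1| ≤ δ)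
    {u x : ℝ} (hu : u ∈ s) (hx : x ∈ s) :
    |ψ x - x - (ψ u - u)| ≤ δ * |x - u| :=
  hs.norm_image_sub_le_of_norm_hasDerivWithin_le (f := fun y => ψ y - y)
    (fun y hy => ((hderiv y hy).sub (hasDerivAt_id y)).hasDerivWithinAt) hδ hu hx



/-- There is `δ > 0` such that for any `C¹` diffeomorphism `ψ` of
`J = (-1,1)` onto its image with `d₁(ψ, id) < δ` and `ψ ≠ id`, after possibly replacing
`ψ` by `ψ⁻¹` (the map `χ` below equals `ψ` or has `ψ` as its inverse), there are
`a < b < c < d` in `J`, with `χ, χ⁻¹` defined on an open interval `V ⊇ [a,d]`, such that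
(1) `χ²([a,b]) ⊂ (b,c)`, (2) `χ⁻¹([b,c]) ⊂ (a,c)`, (3) `χ⁻²([c,d]) ⊂ (b,c)`,
(4) `χ([b,c]) ⊂ (b,d)`. -/
theorem scattering_map_iterated_function_system :
    ∃ δ : ℝ, 0 < δ ∧
      ∀ ψ ψ' : ℝ → ℝ,
        (∀ u ∈ Set.Ioo (-1 : ℝ) 1, HasDerivAt ψ (ψ' u) u) →
        ContinuousOn ψ' (Set.Ioo (-1 : ℝ) 1) →
        Set.InjOn ψ (Set.Ioo (-1 : ℝ) 1) →
        (∀ u ∈ Set.Ioo (-1 : ℝ) 1, |ψ u - u| < δ ∧ |ψ' u - 1| < δ) →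
        (∃ u ∈ Set.Ioo (-1 : ℝ) 1, ψ u ≠ u) →
        ∃ (χ χinv : ℝ → ℝ) (a b c d : ℝ) (V : Set ℝ),
          -- `χ = ψ^{+1}` or `χ = ψ^{-1}`
          ((∀ x ∈ V, χ x = ψ x) ∨ (∀ x ∈ V, χinv x = ψ x)) ∧
          -- `χ` and `χ⁻¹` are defined and mutually inverse on an open interval
          -- `V ⊆ J` containing `[a,d]`
          IsOpen V ∧ V.OrdConnected ∧ Set.Icc a d ⊆ V ∧ V ⊆ Set.Ioo (-1 : ℝ) 1 ∧
          (∀ x ∈ V, χinv (χ x) = x) ∧ (∀ x ∈ V, χ (χinv x) = x) ∧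
          -1 < a ∧ a < b ∧ b < c ∧ c < d ∧ d < 1 ∧
          (∀ x ∈ Set.Icc a b, χ x ∈ V ∧ χ (χ x) ∈ Set.Ioo b c) ∧
          (∀ x ∈ Set.Icc b c, χinv x ∈ Set.Ioo a c) ∧
          (∀ x ∈ Set.Icc c d, χinv x ∈ V ∧ χinv (χinv x) ∈ Set.Ioo b c) ∧
          (∀ x ∈ Set.Icc b c, χ x ∈ Set.Ioo b d) := by
  refine ⟨1 / 1000, by norm_num, ?_⟩
  rintro ψ ψ' hderiv - hinj hclose ⟨u, hu, hne⟩
  obtain ⟨h, hh⟩ : ∃ h, h = ψ u - u := ⟨_, rfl⟩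
  have hh0 : h ≠ 0 := hh ▸ sub_ne_zero.2 hne
  have ht : 0 < |h| := abs_pos.2 hh0
  have htδ : |h| < 1 / 1000 := hh ▸ (hclose u hu).1
  obtain ⟨l, hl, hlr, hul, hur⟩ :
      ∃ l, -1 < l ∧ l + 20 * |h| < 1 ∧ l ≤ u ∧ u ≤ l + 20 * |h| := by
    obtain ⟨hu₁, hu₂⟩ := hu
    rcases le_total u 0 with h0 | h0
    · exact ⟨u, by linarith, by linarith, by linarith, by linarith⟩
    · exact ⟨u - 20 * |h|, by linarith, by linarith, by linarith, by linarith⟩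
  have hIJ : Set.Icc l (l + 20 * |h|) ⊆ Set.Ioo (-1 : ℝ) 1 :=
    fun x hx => ⟨hl.trans_le hx.1, hx.2.trans_lt hlr⟩
  have hVI : Set.Ioo (l + 2 * |h|) (l + 18 * |h|) ⊆ Set.Icc l (l + 20 * |h|) :=
    fun x hx => ⟨by linarith [hx.1], by linarith [hx.2]⟩
  have hψ : ∀ x ∈ Set.Icc l (l + 20 * |h|), |ψ x - x - h| ≤ |h| / 10 := fun x hx => by
    have h₁ := abs_displacement_sub_le (convex_Ioo (-1 : ℝ) 1) hderiv
      (fun v hv => (hclose v hv).2.le) hu (hIJ hx)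
    have h₂ : |x - u| ≤ 20 * |h| :=
      abs_le.2 ⟨by linarith [hx.1], by linarith [hx.2]⟩
    rw [← hh] at h₁
    linarith
  have hcont : ContinuousOn ψ (Set.Icc l (l + 20 * |h|)) :=
    fun x hx => (hderiv x (hIJ hx)).continuousAt.continuousWithinAt
  obtain ⟨g, hg⟩ : ∃ g : ℝ → ℝ, Set.LeftInvOn g ψ (Set.Ioo (-1) 1) :=
    ⟨_, hinj.leftInvOn_invFunOn⟩
  have hgψ : ∀ x ∈ Set.Ioo (l + 2 * |h|) (l + 18 * |h|), g (ψ x) = x :=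
    fun x hx => hg (hIJ (hVI hx))
  have hg' : ∀ x ∈ Set.Ioo (l + 2 * |h|) (l + 18 * |h|),
      ψ (g x) = x ∧ |g x - x + h| ≤ |h| / 10 := fun x hx => by
    obtain ⟨y, hy, rfl, hyx⟩ := exists_preimage_of_approx_translation hcont hψ hx
    rw [hg (hIJ hy)]
    exact ⟨rfl, hyx⟩
  rcases hh0.lt_or_gt with hneg | hpos
  · have habs : |h| = -h := abs_of_neg hneg
    obtain ⟨a, b, c, d, ha, hab, hbc, hcd, hd, h₁, h₂, h₃, h₄⟩ :=
      exists_inclusions_of_approx_translation (χ := g) (χinv := ψ) (l := l) ht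
        (fun x hx => by simpa [habs] using (hg' x hx).2)
        (fun x hx => by simpa [habs, ← sub_eq_add_neg] using hψ x (hVI hx))
    exact ⟨g, ψ, a, b, c, d, _, Or.inr fun _ _ => rfl, isOpen_Ioo, Set.ordConnected_Ioo,
      Set.Icc_subset_Ioo ha hd, hVI.trans hIJ, fun x hx => (hg' x hx).1, hgψ,
      by linarith, hab, hbc, hcd, by linarith, h₁, h₂, h₃, h₄⟩
  · have habs : |h| = h := abs_of_pos hpos
    obtain ⟨a, b, c, d, ha, hab, hbc, hcd, hd, h₁, h₂, h₃, h₄⟩ :=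
      exists_inclusions_of_approx_translation (χ := ψ) (χinv := g) (l := l) ht
        (fun x hx => by simpa [habs] using hψ x (hVI hx))
        (fun x hx => by simpa [habs] using (hg' x hx).2)
    exact ⟨ψ, g, a, b, c, d, _, Or.inl fun _ _ => rfl, isOpen_Ioo, Set.ordConnected_Ioo,
      Set.Icc_subset_Ioo ha hd, hVI.trans hIJ, hgψ, fun x hx => (hg' x hx).1,
      by linarith, hab, hbc, hcd, by linarith, h₁, h₂, h₃, h₄⟩
end

section
/- Let ψ be a homeomorphism from an open interval U ⊂ ℝ onto ψ(U) ⊂ ℝ, and let a < b < c < d be reals with [a,d] ⊂ U ∩ ψ(U) such that ψ²([a,b]) ⊂ (b,c), ψ^{-1}([b,c]) ⊂ (a,c), ψ^{-2}([c,d]) ⊂ (b,c), and ψ([b,c]) ⊂ (b,d). Define X ⊂ Σ = {0,1}^ℤ to be the set of sequences ω for which there exists a bi-infinite sequence (x_i)_{i∈ℤ} with x_i ∈ [a,d] for all i and x_{i+1} = ψ(x_i) when ω_i = 0 and x_{i+1} = ψ^{-1}(x_i) when ω_i = 1. Then X is a nonempty closed subset of Σ invariant under the shift σ, and the topological entropy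 of σ restricted to X is positive. -/
open Dynamics Set Filter Topology Uniformity

/-- The sequence which reads `e k, !e k` at the positions `2 * k, 2 * k + 1`. -/
def pairedSequence (e : ℤ → Bool) (i : ℤ) : Bool :=
  if Even i then e (i / 2) else !e (i / 2)

lemma pairedSequence_two_mul (e : ℤ → Bool) (k : ℤ) : pairedSequence e (2 * k) = e k := by
  simp [pairedSequence]

/-- The extension by `false` of a finite word to a bi-infinite sequence. -/
def extendWord {m : ℕ} (w : Fin m → Bool) (k : ℤ) : Bool :=
  if h : k.toNat < m then w ⟨k.toNat, h⟩ else false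

lemma pairedSequence_extendWord {m : ℕ} (w : Fin m → Bool) (j : Fin m) :
    pairedSequence (extendWord w) (2 * (j : ℕ)) = w j := by
  simp [pairedSequence_two_mul, extendWord]

lemma iterate_shift (k : ℕ) (ω : ℤ → Bool) (i : ℤ) :
    (fun (ω : ℤ → Bool) i => ω (i + 1))^[k] ω i = ω (i + k) := by
  induction k generalizing ω with
  | zero => simp
  | succ k ih =>
    rw [Function.iterate_succ_apply, ih]
    congr 1
    push_cast
    ring

/-- The entourage of pairs of sequences with the same symbol at `0`. -/
def zeroEntourage : SetRel (ℤ → Bool) (ℤ → Bool) := {p | p.1 0 = p.2 0}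

lemma zeroEntourage_mem_uniformity : zeroEntourage ∈ 𝓤 (ℤ → Bool) := by
  have h := Pi.uniformContinuous_proj (fun _ : ℤ => Bool) 0
  have hd : SetRel.id ∈ 𝓤 Bool := by
    rw [DiscreteUniformity.eq_principal_setRelId]
    exact mem_principal_self _
  filter_upwards [h hd] with p hp
  exact hp

/-- Sequences built from freely chosen pairs `01`, `10` give a subshift of entropy
`log 2 / 2`. -/
lemma coverEntropy_shift_pos {X : Set (ℤ → Bool)} (hX : ∀ e, pairedSequence e ∈ X) :
    0 < coverEntropy (fun (ω : ℤ → Bool) i => ω (i + 1)) X := by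
  classical
  refine lt_of_lt_of_le ?_
    (netEntropyEntourage_le_coverEntropy _ X zeroEntourage_mem_uniformity)
  set T : (ℤ → Bool) → ℤ → Bool := fun ω i => ω (i + 1) with hT
  set u : ℕ → ENNReal := fun n => (netMaxcard T X zeroEntourage n).toENNReal with hu
  have hmono : Monotone u := fun _ _ h =>
    ENat.toENNReal_mono (netMaxcard_monotone_time T X zeroEntourage h)
  have hcard (m : ℕ) : (2 : ENNReal) ^ m ≤ u (2 * m) := by
    have hinj : Function.Injective fun w : Fin m → Bool => pairedSequence (extendWord w) := by
      intro w w' h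
      ext j : 1
      simpa [pairedSequence_extendWord] using congrFun h (2 * (j : ℕ))
    have hnet : IsDynNetIn T X zeroEntourage (2 * m)
        ((Finset.univ.image fun w : Fin m → Bool => pairedSequence (extendWord w) :
          Finset (ℤ → Bool)) : Set (ℤ → Bool)) := by
      constructor
      · intro ω hω
        simp only [Finset.coe_image, Finset.coe_univ, image_univ, mem_range] at hω
        obtain ⟨w, rfl⟩ := hω
        exact hX _
      · intro ω hω ω' hω' hne
        simp only [Finset.coe_image, Finset.coe_univ, image_univ, mem_range] at hω hω'
        obtain ⟨w, rfl⟩ := hω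
        obtain ⟨w', rfl⟩ := hω'
        refine Set.disjoint_left.2 fun z hz hz' => hne ?_
        congr 2
        ext j : 1
        rw [mem_ball_dynEntourage] at hz hz'
        have hj : 2 * (j : ℕ) < 2 * m := by omega
        have e1 : T^[2 * (j : ℕ)] (pairedSequence (extendWord w)) 0 = T^[2 * (j : ℕ)] z 0 :=
          hz _ hj
        have e2 : T^[2 * (j : ℕ)] (pairedSequence (extendWord w')) 0 = T^[2 * (j : ℕ)] z 0 :=
          hz' _ hj
        have e := e1.trans e2.symm
        rw [hT, iterate_shift, iterate_shift] at e
        simpa [pairedSequence_extendWord] using e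
    have h := hnet.card_le_netMaxcard
    rw [Finset.card_image_of_injective _ hinj] at h
    have h' := ENat.toENNReal_mono h
    simpa using h'
  have hgrowth : ENNReal.log 2 ≤ 2 * ExpGrowth.expGrowthSup u := by
    have h := hmono.expGrowthSup_comp_mul two_ne_zero
    rw [← ExpGrowth.expGrowthSup_pow]
    refine (ExpGrowth.expGrowthSup_monotone fun m => hcard m).trans ?_
    simpa [Function.comp_def] using h.le
  have hlog : 0 < ENNReal.log 2 := by
    rw [← ENNReal.log_one]
    exact ENNReal.log_strictMono ENNReal.one_lt_two
  by_contra hneg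
  exact absurd (hlog.trans_le hgrowth) (not_lt.2 (mul_nonpos_of_nonneg_of_nonpos
    zero_le_two (not_lt.1 hneg)))

/-- The itineraries of the points of a compact set under two maps continuous on it form a
closed set. -/
lemma isClosed_itineraries {K : Set ℝ} (hK : IsCompact K) {f g : ℝ → ℝ}
    (hf : ContinuousOn f K) (hg : ContinuousOn g K) :
    IsClosed {ω : ℤ → Bool | ∃ x : ℤ → ℝ, (∀ i : ℤ, x i ∈ K) ∧
      ∀ i : ℤ, (ω i = false → x (i + 1) = f (x i)) ∧ (ω i = true → x (i + 1) = g (x i))} := by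
  have : CompactSpace K := isCompact_iff_compactSpace.1 hK
  have hC : IsClosed {p : (ℤ → K) × (ℤ → Bool) | ∀ i : ℤ,
      (p.2 i = false → (p.1 (i + 1) : ℝ) = f (p.1 i)) ∧
        (p.2 i = true → (p.1 (i + 1) : ℝ) = g (p.1 i))} := by
    have hsymbol (i : ℤ) (s : Bool) : IsOpen {p : (ℤ → K) × (ℤ → Bool) | p.2 i = s} := by
      have hc : Continuous fun p : (ℤ → K) × (ℤ → Bool) => p.2 i := by fun_prop
      exact (isOpen_discrete {s}).preimage hc
    have hstep {h : ℝ → ℝ} (hh : ContinuousOn h K) (i : ℤ) :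
        IsClosed {p : (ℤ → K) × (ℤ → Bool) | (p.1 (i + 1) : ℝ) = h (p.1 i)} := by
      refine isClosed_eq (by fun_prop) ?_
      exact hh.domRestrict.comp ((continuous_apply i).comp continuous_fst)
    simp only [ofPred_forall, ofPred_and]
    exact isClosed_iInter fun i =>
      (isClosed_imp (hsymbol i false) (hstep hf i)).inter
        (isClosed_imp (hsymbol i true) (hstep hg i))
  convert isClosedMap_snd_of_compactSpace _ hC using 1
  ext ω
  constructor
  · rintro ⟨x, hx, hω⟩
    exact ⟨(fun i => ⟨x i, hx i⟩, ω), hω, rfl⟩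
  · rintro ⟨⟨x, η⟩, hω, rfl⟩
    exact ⟨fun i => x i, fun i => (x i).2, hω⟩

/-- Positive entropy of the subshift of bounded itineraries.  Let `ψ`
be a homeomorphism from an open interval `U` onto `ψ(U)` and `a < b < c < d` with
`[a,d] ⊆ U ∩ ψ(U)` satisfying `ψ²([a,b]) ⊂ (b,c)`, `ψ⁻¹([b,c]) ⊂ (a,c)`,
`ψ⁻²([c,d]) ⊂ (b,c)`, `ψ([b,c]) ⊂ (b,d)`.  Let `X ⊆ {0,1}^ℤ` be the set of sequences
`ω` admitting a bi-infinite orbit `(x_i)` in `[a,d]` with `x_{i+1} = ψ(x_i)` when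
`ω_i = 0` and `x_{i+1} = ψ⁻¹(x_i)` when `ω_i = 1`.  Then `X` is a nonempty closed
shift-invariant subset of `{0,1}^ℤ` and the shift restricted to `X` has positive
topological entropy. -/
theorem bounded_itinerary_subshift_positive_entropy
    (U : Set ℝ) (hUopen : IsOpen U) (hUconn : U.OrdConnected)
    (ψ ψinv : ℝ → ℝ)
    (hψcont : ContinuousOn ψ U) (hψinvcont : ContinuousOn ψinv (ψ '' U))
    (hleft : ∀ x ∈ U, ψinv (ψ x) = x) (hright : ∀ y ∈ ψ '' U, ψ (ψinv y) = y)
    (a b c d : ℝ) (hab : a < b) (hbc : b < c) (hcd : c < d)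
    (had : Set.Icc a d ⊆ U ∩ ψ '' U)
    (h1 : ∀ x ∈ Set.Icc a b, ψ x ∈ U ∧ ψ (ψ x) ∈ Set.Ioo b c)
    (h2 : ∀ x ∈ Set.Icc b c, ψinv x ∈ Set.Ioo a c)
    (h3 : ∀ x ∈ Set.Icc c d, ψinv x ∈ ψ '' U ∧ ψinv (ψinv x) ∈ Set.Ioo b c)
    (h4 : ∀ x ∈ Set.Icc b c, ψ x ∈ Set.Ioo b d) :
    let σ : (ℤ → Bool) → (ℤ → Bool) := fun ω i => ω (i + 1)
    let X : Set (ℤ → Bool) := {ω | ∃ x : ℤ → ℝ,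
      (∀ i : ℤ, x i ∈ Set.Icc a d) ∧
      ∀ i : ℤ, (ω i = false → x (i + 1) = ψ (x i)) ∧
        (ω i = true → x (i + 1) = ψinv (x i))}
    X.Nonempty ∧ IsClosed X ∧ σ '' X = X ∧ 0 < coverEntropy σ X := by
  intro σ X
  have hpaired (e : ℤ → Bool) : pairedSequence e ∈ X := by
    have hb : b ∈ Icc b c := ⟨le_rfl, hbc.le⟩
    have hbI : b ∈ Icc a d := ⟨hab.le, (hbc.trans hcd).le⟩
    have hψ := h4 b hb
    have hψinv := h2 b hb
    refine ⟨fun i => if Even i then b else if e (i / 2) then ψinv b else ψ b, fun i => ?_,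
      fun i => ?_⟩
    · dsimp only
      split_ifs
      · exact hbI
      · exact ⟨hψinv.1.le, (hψinv.2.trans hcd).le⟩
      · exact ⟨(hab.trans hψ.1).le, hψ.2.le⟩
    · rcases Int.even_or_odd i with hi | hi
      · have hi' : ¬ Even (i + 1) := by simpa [Int.even_add_one] using hi
        have hdiv : (i + 1) / 2 = i / 2 := by
          obtain ⟨k, rfl⟩ := hi
          omega
        cases he : e (i / 2) <;> simp [pairedSequence, hi, hi', hdiv, he]
      · have hi' : Even (i + 1) := hi.add_one
        have hi'' : ¬ Even i := Int.not_even_iff_odd.2 hi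
        cases he : e (i / 2) <;>
          simp [pairedSequence, hi', hi'', he, hleft b (had hbI).1, hright b (had hbI).2]
  refine ⟨⟨_, hpaired fun _ => false⟩, ?_, ?_, coverEntropy_shift_pos hpaired⟩
  · exact isClosed_itineraries isCompact_Icc (hψcont.mono fun x hx => (had hx).1)
      (hψinvcont.mono fun x hx => (had hx).2)
  · ext ω
    constructor
    · rintro ⟨η, ⟨x, hx, hη⟩, rfl⟩
      exact ⟨fun i => x (i + 1), fun i => hx _, fun i => hη (i + 1)⟩
    · rintro ⟨x, hx, hω⟩
      refine ⟨fun i => ω (i - 1), ⟨fun i => x (i - 1), fun i => hx _, fun i => ?_⟩, ?_⟩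
      · simpa using hω (i - 1)
      · ext i : 1
        simp [σ]
end

section
/- Let ψ be a homeomorphism from an open interval U ⊂ ℝ onto ψ(U) ⊂ ℝ, and let a < b < c < d be reals with [a,d] ⊂ U ∩ ψ(U) such that ψ²([a,b]) ⊂ (b,c), ψ^{-1}([b,c]) ⊂ (a,c), ψ^{-2}([c,d]) ⊂ (b,c), and ψ([b,c]) ⊂ (b,d). Then there exists ε > 0 (depending on ψ, a, b, c, d) with the following property. Let Ω' ⊂ {1,2}^ℤ be the subshift of finite type of sequences in which neither of the words 121 and 212 occurs. Suppose g_{11}, g_{12}, g_{21}, g_{22} are continuous injective maps defined on an open interval containing [a,d] such that sup_{[a,d]} |g_{11} − ψ| < ε, sup_{[a,d]} |g_{22} − ψ^{-1}| < ε, sup_{[a,d]} |g_{12} − id| < ε, and sup_{[a,d]} |g_{21} − id| < ε. Then the set X' of sequences ν ∈ Ω' for which there exists a bi-infinite sequence (x_i)_{i∈ℤ} with x_i ∈ [a,d] and x_{i+1} = g_{ν_i ν_{i+1}}(x_i) for all i ∈ ℤ is a nonempty closed shift-invariant subset of Ω', and the topological entropy of the shift restricted to X' is positive. -/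
open Dynamics

section Orbits

open Set Filter Topology

variable {E : Type*}

/-- `IsStep f p i` says that `p` performs an admissible step of the iterated function system `f`
at time `i`, where the symbol may change at time `i` only if it did not change just before. -/
def IsStep (f : Bool → Bool → E → E) (p : ℤ → Bool × E) (i : ℤ) : Prop :=
  (p (i + 1)).2 = f (p i).1 (p (i + 1)).1 (p i).2 ∧
    ((p (i - 1)).1 = (p i).1 ∨ (p i).1 = (p (i + 1)).1)

/-- `p` takes its values in `I`, and its steps at the times of `S` before `m` are admissible. -/
def IsOrbitUntil (f : Bool → Bool → E → E) (I : Set E) (S : Set ℤ) (m : ℤ)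
    (p : ℤ → Bool × E) : Prop :=
  (∀ i, (p i).2 ∈ I) ∧ ∀ i ∈ S, i < m → IsStep f p i

/-- At time `m`, the orbit `p` is in `C` and free to choose its next symbol. -/
def IsFreeAt (C : Set E) (m : ℤ) (p : ℤ → Bool × E) : Prop :=
  (p (m - 1)).1 = (p m).1 ∧ (p m).2 ∈ C

/-- The symbol `s` keeps the core `C` inside `A s`, switching symbols maps `C` to `A (!s)`, and
from every point of `A s` outside `C` one returns to `C` by switching and then applying the new
symbol twice. -/
structure IsReturning (f : Bool → Bool → E → E) (I C : Set E) (A : Bool → Set E) : Prop where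
  core_subset : C ⊆ I
  subset : ∀ s, A s ⊆ I
  stay : ∀ s, ∀ x ∈ C, f s s x ∈ A s
  switch : ∀ s, ∀ x ∈ C, f s (!s) x ∈ I ∧ f (!s) (!s) (f s (!s) x) ∈ A (!s)
  back : ∀ s, ∀ x ∈ A s, x ∈ C ∨ (f s (!s) x ∈ I ∧ f (!s) (!s) (f s (!s) x) ∈ I ∧
    f (!s) (!s) (f (!s) (!s) (f s (!s) x)) ∈ C)

variable {f : Bool → Bool → E → E} {I C : Set E} {A : Bool → Set E} {S : Set ℤ} {m : ℤ}
  {p q : ℤ → Bool × E}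

lemma IsStep.congr {i : ℤ} (h : IsStep f p i) (h₀ : (q (i - 1)).1 = (p (i - 1)).1)
    (h₁ : q i = p i) (h₂ : q (i + 1) = p (i + 1)) : IsStep f q i := by
  unfold IsStep
  rw [h₀, h₁, h₂]
  exact h

lemma IsOrbitUntil.extend (h : IsOrbitUntil f I S m p) {s t : Bool} {x : E} (hm : p m = (s, x))
    (hI : f s t x ∈ I) (ht : (p (m - 1)).1 = s ∨ s = t) :
    ∃ q, (∀ i ≤ m, q i = p i) ∧ q (m + 1) = (t, f s t x) ∧ IsOrbitUntil f I S (m + 1) q := by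
  have hq : ∀ i ≤ m, Function.update p (m + 1) (t, f s t x) i = p i := fun i hi =>
    Function.update_of_ne (by omega) _ _
  refine ⟨Function.update p (m + 1) (t, f s t x), hq, Function.update_self .., fun i => ?_,
    fun i hi him => ?_⟩
  · rcases eq_or_ne i (m + 1) with rfl | hi
    · rw [Function.update_self]; exact hI
    · rw [Function.update_of_ne hi]; exact h.1 i
  · rcases (Int.lt_add_one_iff.1 him).lt_or_eq with hlt | rfl
    · refine (h.2 i hi hlt).congr ?_ ?_ ?_ <;> rw [hq _ (by omega)]
    · unfold IsStep
      rw [Function.update_self, hq _ le_rfl, hq _ (by omega), hm]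
      exact ⟨rfl, ht⟩

lemma IsReturning.exists_isFreeAt_of_mem (hA : IsReturning f I C A) (h : IsOrbitUntil f I S m p)
    {s : Bool} {x : E} (hm : p m = (s, x)) (hs : (p (m - 1)).1 = s) (hx : x ∈ A s) :
    ∃ q n, m ≤ n ∧ n ≤ m + 3 ∧ (∀ i ≤ m, q i = p i) ∧ IsOrbitUntil f I S n q ∧
      IsFreeAt C n q := by
  rcases hA.back s x hx with hC | ⟨h₁, h₂, h₃⟩
  · refine ⟨p, m, le_rfl, by omega, fun _ _ => rfl, h, ?_⟩
    rw [IsFreeAt, hm]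
    exact ⟨hs, hC⟩
  obtain ⟨p₁, e₁, v₁, o₁⟩ := h.extend hm h₁ (Or.inl hs)
  obtain ⟨p₂, e₂, v₂, o₂⟩ := o₁.extend v₁ h₂ (Or.inr rfl)
  obtain ⟨p₃, e₃, v₃, o₃⟩ := o₂.extend v₂ (hA.core_subset h₃) (Or.inr rfl)
  refine ⟨p₃, m + 1 + 1 + 1, by omega, by omega, fun i hi => ?_, o₃, ?_⟩
  · rw [e₃ i (by omega), e₂ i (by omega), e₁ i hi]
  · rw [IsFreeAt, v₃, add_sub_cancel_right, e₃ _ le_rfl, v₂]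
    exact ⟨rfl, h₃⟩

lemma IsReturning.exists_isFreeAt (hA : IsReturning f I C A) (h : IsOrbitUntil f I S m p)
    (hp : IsFreeAt C m p) (t : Bool) :
    ∃ q n, m + 1 ≤ n ∧ n ≤ m + 5 ∧ (∀ i ≤ m, q i = p i) ∧ (q (m + 1)).1 = t ∧
      IsOrbitUntil f I S n q ∧ IsFreeAt C n q := by
  obtain ⟨s, x, hm⟩ : ∃ s x, p m = (s, x) := ⟨_, _, rfl⟩
  obtain ⟨hs, hx⟩ := hp
  rw [hm] at hs hx
  by_cases hst : t = s
  · subst hst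
    have hx' := hA.stay t x hx
    obtain ⟨p₁, e₁, v₁, o₁⟩ := h.extend hm (hA.subset t hx') (Or.inr rfl)
    obtain ⟨q, n, hn, hn', e, o, c⟩ := hA.exists_isFreeAt_of_mem o₁ v₁
      (by rw [add_sub_cancel_right, e₁ _ le_rfl, hm]) hx'
    refine ⟨q, n, hn, by omega, fun i hi => ?_, ?_, o, c⟩
    · rw [e i (by omega), e₁ i hi]
    · rw [e _ le_rfl, v₁]
  · obtain rfl : t = !s := Bool.eq_not.2 hst
    obtain ⟨h₁, h₂⟩ := hA.switch s x hx
    obtain ⟨p₁, e₁, v₁, o₁⟩ := h.extend hm h₁ (Or.inl hs)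
    obtain ⟨p₂, e₂, v₂, o₂⟩ := o₁.extend v₁ (hA.subset _ h₂) (Or.inr rfl)
    obtain ⟨q, n, hn, hn', e, o, c⟩ := hA.exists_isFreeAt_of_mem o₂ v₂
      (by rw [add_sub_cancel_right, e₂ _ le_rfl, v₁]) h₂
    refine ⟨q, n, by omega, by omega, fun i hi => ?_, ?_, o, c⟩
    · rw [e i (by omega), e₂ i (by omega), e₁ i hi]
    · rw [e _ (by omega), e₂ _ le_rfl, v₁]

/-- A two-sided orbit that is free at time `0` branches into a tree of orbits, with a free choice
at least every five steps. -/
lemma IsReturning.exists_branching (hA : IsReturning f I C A) (h : IsOrbitUntil f I univ 0 p)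
    (hp : IsFreeAt C 0 p) :
    ∃ Φ : (ℕ → Bool) → ℤ → Bool × E,
      (∀ β i, (Φ β i).2 ∈ I ∧ IsStep f (Φ β) i) ∧
      ∀ β β' k, β k ≠ β' k → ∃ j : ℕ, j ≤ 5 * (k + 1) ∧ (Φ β j).1 ≠ (Φ β' j).1 := by
  let Q := {q : (ℤ → Bool × E) × ℤ // IsOrbitUntil f I univ q.2 q.1 ∧ IsFreeAt C q.2 q.1}
  have hnext : ∀ (t : Bool) (q : Q), ∃ r : Q, q.1.2 + 1 ≤ r.1.2 ∧ r.1.2 ≤ q.1.2 + 5 ∧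
      (∀ i ≤ q.1.2, r.1.1 i = q.1.1 i) ∧ (r.1.1 (q.1.2 + 1)).1 = t := fun t q => by
    obtain ⟨r, n, h₁, h₂, h₃, h₄, h₅, h₆⟩ := hA.exists_isFreeAt q.2.1 q.2.2 t
    exact ⟨⟨(r, n), h₅, h₆⟩, h₁, h₂, h₃, h₄⟩
  choose next hlt hle hagree hsymb using hnext
  let z : (ℕ → Bool) → ℕ → Q := fun β k =>
    Nat.rec ⟨(p, 0), h, hp⟩ (fun k q => next (β k) q) k
  have z_succ : ∀ β k, z β (k + 1) = next (β k) (z β k) := fun _ _ => rfl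
  have z_ge : ∀ β (k : ℕ), (k : ℤ) ≤ (z β k).1.2 := fun β k => by
    induction k with
    | zero => exact le_rfl
    | succ k ih => have := hlt (β k) (z β k); rw [z_succ]; push_cast; omega
  have z_le : ∀ β (k : ℕ), (z β k).1.2 ≤ 5 * k := fun β k => by
    induction k with
    | zero => exact le_rfl
    | succ k ih => have := hle (β k) (z β k); rw [z_succ]; push_cast; omega
  have z_mono : ∀ β, Monotone fun k => (z β k).1.2 := fun β => monotone_nat_of_le_succ fun k => by
    have := hlt (β k) (z β k); simp only [z_succ]; omega
  have z_agree : ∀ β k l, k ≤ l → ∀ i ≤ (z β k).1.2, (z β l).1.1 i = (z β k).1.1 i := by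
    intro β k l hkl i hi
    induction l, hkl using Nat.le_induction with
    | base => rfl
    | succ l hl ih => rw [z_succ, hagree _ _ _ (hi.trans (z_mono β hl)), ih]
  let Φ : (ℕ → Bool) → ℤ → Bool × E := fun β i => (z β i.toNat).1.1 i
  have Φ_eq : ∀ β k, ∀ i ≤ (z β k).1.2, Φ β i = (z β k).1.1 i := by
    intro β k i hi
    rcases le_total i.toNat k with hik | hik
    · exact (z_agree β _ _ hik i ((Int.self_le_toNat i).trans (z_ge β _))).symm
    · exact z_agree β _ _ hik i hi
  refine ⟨Φ, fun β i => ⟨(z β i.toNat).2.1.1 i, ?_⟩, fun β β' k hk => ?_⟩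
  · have hi : i + 1 ≤ (z β (i + 1).toNat).1.2 := (Int.self_le_toNat _).trans (z_ge β _)
    refine ((z β (i + 1).toNat).2.1.2 i (mem_univ i) (by omega)).congr ?_ ?_ ?_ <;>
      rw [Φ_eq β (i + 1).toNat _ (by omega)]
  · have hex : ∃ k, β k ≠ β' k := ⟨k, hk⟩
    classical
    let l := Nat.find hex
    have hl : β l ≠ β' l := Nat.find_spec hex
    have hlk : l ≤ k := Nat.find_min' hex hk
    have hz : ∀ j ≤ l, z β j = z β' j := fun j hj => by
      induction j with
      | zero => rfl
      | succ j ih =>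
        have : β j = β' j := not_not.1 (Nat.find_min hex (show j < l by omega))
        rw [z_succ, z_succ, ih (by omega), this]
    have key : ∀ γ : ℕ → Bool, (Φ γ ((z γ l).1.2 + 1)).1 = γ l := fun γ => by
      rw [Φ_eq γ (l + 1) _ (hlt (γ l) (z γ l)), z_succ, hsymb]
    have h0 := z_ge β l
    have h5 := z_le β l
    refine ⟨((z β l).1.2 + 1).toNat, by omega, ?_⟩
    rw [Int.toNat_of_nonneg (by omega), key β, hz l le_rfl, key β']
    exact hl

lemma IsReturning.exists_isFreeAt_ge (hA : IsReturning f I C A) (hC : C.Nonempty) (n : ℕ) :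
    ∃ p m, (n : ℤ) ≤ m ∧ IsOrbitUntil f I (Ici 0) m p ∧ IsFreeAt C m p := by
  induction n with
  | zero =>
    obtain ⟨x, hx⟩ := hC
    exact ⟨fun _ => (false, x), 0, le_rfl, ⟨fun _ => hA.core_subset hx,
      fun i hi hi' => absurd hi' (not_lt.2 hi)⟩, rfl, hx⟩
  | succ n ih =>
    obtain ⟨p, m, hm, ho, hc⟩ := ih
    obtain ⟨q, m', h₁, -, -, -, h₂, h₃⟩ := hA.exists_isFreeAt ho hc true
    exact ⟨q, m', by push_cast; omega, h₂, h₃⟩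

variable [TopologicalSpace E]

lemma isCompact_setOf_forall_mem (hI : IsCompact I) :
    IsCompact {p : ℤ → Bool × E | ∀ i, (p i).2 ∈ I} := by
  convert isCompact_univ_pi fun _ : ℤ => (isCompact_univ (X := Bool)).prod hI using 1
  ext p
  simp [Set.mem_pi]

variable [T2Space E]

lemma isClosed_setOf_isStep (hI : IsClosed I) (hf : ∀ s t, ContinuousOn (f s t) I) (i : ℤ) :
    IsClosed {p : ℤ → Bool × E | (p i).2 ∈ I ∧ IsStep f p i} := by
  have hev : ∀ j : ℤ, Continuous fun p : ℤ → Bool × E => p j := continuous_apply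
  have hsymb : ∀ j : ℤ, ∀ s : Bool, IsClosed {p : ℤ → Bool × E | (p j).1 = s} := fun j s =>
    isClosed_eq (continuous_fst.comp (hev j)) continuous_const
  have hgraph : ∀ s t, IsClosed {p : ℤ → Bool × E | (p i).2 ∈ I ∧
      (p (i + 1)).2 = f s t (p i).2} := fun s t => by
    have h1 : ContinuousOn (fun p : ℤ → Bool × E => ((p (i + 1)).2, f s t (p i).2))
        {p | (p i).2 ∈ I} :=
      (continuous_snd.comp (hev _)).continuousOn.prodMk
        ((hf s t).comp (continuous_snd.comp (hev i)).continuousOn fun p hp => hp)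
    exact h1.preimage_isClosed_of_isClosed (hI.preimage (continuous_snd.comp (hev i)))
      isClosed_diagonal
  have heq : {p : ℤ → Bool × E | (p i).2 ∈ I ∧ IsStep f p i} =
      (⋃ s, ⋃ t, {p | (p i).1 = s} ∩ {p | (p (i + 1)).1 = t} ∩
        {p | (p i).2 ∈ I ∧ (p (i + 1)).2 = f s t (p i).2}) ∩
      ({p | (p (i - 1)).1 = (p i).1} ∪ {p | (p i).1 = (p (i + 1)).1}) := by
    ext p
    simp only [IsStep, mem_ofPred_eq, mem_inter_iff, mem_iUnion, mem_union]
    constructor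
    · rintro ⟨h₁, h₂, h₃⟩
      exact ⟨⟨_, _, ⟨rfl, rfl⟩, h₁, h₂⟩, h₃⟩
    · rintro ⟨⟨s, t, ⟨rfl, rfl⟩, h₁, h₂⟩, h₃⟩
      exact ⟨h₁, h₂, h₃⟩
  rw [heq]
  refine (isClosed_iUnion_of_finite fun s => isClosed_iUnion_of_finite fun t =>
    ((hsymb i s).inter (hsymb _ t)).inter (hgraph s t)).inter (IsClosed.union ?_ ?_) <;>
  exact isClosed_eq (continuous_fst.comp (hev _)) (continuous_fst.comp (hev _))

lemma isClosed_setOf_isOrbitUntil (hI : IsClosed I) (hf : ∀ s t, ContinuousOn (f s t) I) :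
    IsClosed {p | IsOrbitUntil f I S m p} := by
  have heq : {p | IsOrbitUntil f I S m p} = (⋂ i, {p : ℤ → Bool × E | (p i).2 ∈ I}) ∩
      ⋂ i ∈ S ∩ Iio m, {p : ℤ → Bool × E | (p i).2 ∈ I ∧ IsStep f p i} := by
    ext p
    simp only [IsOrbitUntil, mem_ofPred_eq, mem_inter_iff, mem_iInter, mem_Iio]
    exact ⟨fun h => ⟨h.1, fun i hi => ⟨h.1 i, h.2 i hi.1 hi.2⟩⟩,
      fun h => ⟨h.1, fun i hi hi' => (h.2 i ⟨hi, hi'⟩).2⟩⟩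
  rw [heq]
  exact (isClosed_iInter fun i =>
      hI.preimage (continuous_snd.comp (continuous_apply i : Continuous _))).inter
    (isClosed_biInter fun i _ => isClosed_setOf_isStep hI hf i)

lemma IsReturning.exists_past (hA : IsReturning f I C A) (hI : IsCompact I)
    (hf : ∀ s t, ContinuousOn (f s t) I) (hC : C.Nonempty) (hC' : IsClosed C) :
    ∃ p, IsOrbitUntil f I univ 0 p ∧ IsFreeAt C 0 p := by
  let K : ℕ → Set (ℤ → Bool × E) := fun n =>
    {p | IsOrbitUntil f I (Ici (-(n : ℤ))) 0 p} ∩ {p | IsFreeAt C 0 p}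
  have hclosed : ∀ n, IsClosed (K n) := fun n => by
    refine (isClosed_setOf_isOrbitUntil hI.isClosed hf).inter (IsClosed.inter ?_ ?_)
    · exact isClosed_eq (continuous_fst.comp (continuous_apply (0 - 1 : ℤ)))
        (continuous_fst.comp (continuous_apply (0 : ℤ)))
    · exact hC'.preimage (continuous_snd.comp (continuous_apply (0 : ℤ)))
  have hne : (⋂ n, K n).Nonempty := by
    refine IsCompact.nonempty_iInter_of_sequence_nonempty_isCompact_isClosed K ?_ ?_ ?_ hclosed
    · rintro n p ⟨h₁, h₂⟩
      exact ⟨⟨h₁.1, fun i hi => h₁.2 i (by simp only [mem_Ici] at hi ⊢; push_cast; omega)⟩, h₂⟩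
    · intro n
      obtain ⟨p, m, hm, ho, hc⟩ := hA.exists_isFreeAt_ge hC n
      refine ⟨fun i => p (i + m), ⟨fun i => ho.1 _, fun i hi hi' => ?_⟩, ?_⟩
      · have := ho.2 (i + m) (by simp only [mem_Ici] at hi ⊢; omega) (by omega)
        simp only [IsStep] at this ⊢
        rwa [add_right_comm i 1 m, sub_add_eq_add_sub i 1 m]
      · simp only [IsFreeAt, mem_ofPred_eq] at hc ⊢
        rwa [zero_add, sub_add_eq_add_sub, zero_add]
    · exact (isCompact_setOf_forall_mem hI).of_isClosed_subset (hclosed 0) fun p hp => hp.1.1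
  obtain ⟨p, hp⟩ := hne
  rw [mem_iInter] at hp
  exact ⟨p, ⟨(hp 0).1.1, fun i _ hi => (hp i.natAbs).1.2 i (by simp only [mem_Ici]; omega) hi⟩,
    (hp 0).2⟩

end Orbits

open Set Filter Topology in
/-- A set of two-sided sequences containing a tree that branches at a positive rate has positive
entropy. -/
lemma coverEntropy_shift_pos_s12 {X : Set (ℤ → Bool)} (Ψ : (ℕ → Bool) → ℤ → Bool)
    (hΨ : ∀ β, Ψ β ∈ X)
    (hsep : ∀ β β' k, β k ≠ β' k → ∃ j : ℕ, j ≤ 5 * (k + 1) ∧ Ψ β j ≠ Ψ β' j) :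
    0 < coverEntropy (fun (ν : ℤ → Bool) i => ν (i + 1)) X := by
  set σ : (ℤ → Bool) → (ℤ → Bool) := fun ν i => ν (i + 1) with hσ
  have hσ_iter : ∀ (k : ℕ) (ν : ℤ → Bool), σ^[k] ν 0 = ν k := fun k => by
    induction k with
    | zero => exact fun _ => rfl
    | succ k ih => intro ν; rw [Function.iterate_succ_apply, ih]; simp [hσ]
  let V : SetRel (ℤ → Bool) (ℤ → Bool) := {q | q.1 0 = q.2 0}
  have hV : V ∈ uniformity (ℤ → Bool) := by
    have : {q : Bool × Bool | q.1 = q.2} ∈ uniformity Bool :=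
      DiscreteUniformity.relId_mem_uniformity Bool
    rw [Pi.uniformity]
    exact mem_iInf_of_mem 0 (preimage_mem_comap this)
  have hcard : ∀ k : ℕ, 1 ≤ k → ((2 ^ k : ℕ) : ℕ∞) ≤ netMaxcard σ X V (6 * k) := by
    intro k hk
    classical
    let ext : (Fin k → Bool) → ℕ → Bool := fun β i => if h : i < k then β ⟨i, h⟩ else false
    have hext : ∀ β β', β ≠ β' →
        ∃ j : ℕ, j < 6 * k ∧ Ψ (ext β) j ≠ Ψ (ext β') j := by
      intro β β' hne
      obtain ⟨i, hi⟩ := Function.ne_iff.1 hne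
      obtain ⟨j, hj, hj'⟩ := hsep (ext β) (ext β') i (by simpa [ext] using hi)
      exact ⟨j, by have := i.2; omega, hj'⟩
    have hinj : Function.Injective fun β => Ψ (ext β) := fun β β' heq => by
      by_contra hne
      obtain ⟨j, -, hj⟩ := hext β β' hne
      exact hj (congrFun heq j)
    have hnet : IsDynNetIn σ X V (6 * k)
        ((Finset.univ.image fun β => Ψ (ext β) : Finset (ℤ → Bool)) : Set (ℤ → Bool)) := by
      constructor
      · intro ν hν
        obtain ⟨β, -, rfl⟩ := Finset.mem_image.1 (Finset.mem_coe.1 hν)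
        exact hΨ _
      · intro ν hν ν' hν' hne
        obtain ⟨β, -, rfl⟩ := Finset.mem_image.1 (Finset.mem_coe.1 hν)
        obtain ⟨β', -, rfl⟩ := Finset.mem_image.1 (Finset.mem_coe.1 hν')
        obtain ⟨j, hj, hj'⟩ := hext β β' fun h => hne (by rw [h])
        refine Set.disjoint_left.2 fun ν h₁ h₂ => hj' ?_
        have e₁ := mem_ball_dynEntourage.1 h₁ j hj
        have e₂ := mem_ball_dynEntourage.1 h₂ j hj
        simp only [UniformSpace.ball, mem_preimage, V, mem_ofPred_eq, hσ_iter] at e₁ e₂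
        exact e₁.trans e₂.symm
    have := hnet.card_le_netMaxcard
    rwa [Finset.card_image_of_injective _ hinj, Finset.card_univ, Fintype.card_fun,
      Fintype.card_bool, Fintype.card_fin] at this
  refine lt_of_lt_of_le ?_ (netEntropyEntourage_le_coverEntropy (T := σ) (F := X) hV)
  have hpos : (0 : EReal) < ((Real.log 2 / 6 : ℝ) : EReal) :=
    EReal.coe_pos.2 (by positivity)
  refine hpos.trans_le (Frequently.le_expGrowthSup ?_)
  refine Filter.frequently_atTop.2 fun N => ⟨6 * (N + 1), by omega, ?_⟩
  have hexp : EReal.exp (((Real.log 2 / 6 : ℝ) : EReal) * ((6 * (N + 1) : ℕ) : EReal)) =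
      ((2 ^ (N + 1) : ℕ) : ENNReal) := by
    have : ((6 * (N + 1) : ℕ) : EReal) = (((6 * (N + 1) : ℕ) : ℝ) : EReal) := rfl
    rw [this, ← EReal.coe_mul, EReal.exp_coe]
    have : Real.log 2 / 6 * ((6 * (N + 1) : ℕ) : ℝ) = ((N + 1 : ℕ) : ℝ) * Real.log 2 := by
      push_cast; ring
    rw [this, Real.exp_nat_mul, Real.exp_log two_pos, ENNReal.ofReal_pow zero_le_two]
    simp
  rw [hexp]
  exact_mod_cast ENat.toENNReal_mono (hcard (N + 1) (by omega))

section Perturbation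

open Set Filter Topology

variable {E : Type*} [MetricSpace E]

lemma IsCompact.eventually_forall_dist_lt_mem {K O : Set E} (hK : IsCompact K) (hO : IsOpen O)
    (h : K ⊆ O) : ∀ᶠ η : ℝ in 𝓝[>] 0, ∀ x ∈ K, ∀ y, dist y x < η → y ∈ O := by
  obtain ⟨δ, hδ, hsub⟩ := hK.exists_thickening_subset_open hO h
  filter_upwards [Ioo_mem_nhdsGT hδ] with η hη x hx y hy
  exact hsub (Metric.mem_thickening_iff.2 ⟨x, hx, hy.trans hη.2⟩)

lemma IsCompact.eventually_dist_lt_of_continuousOn {I : Set E} (hI : IsCompact I) {h : E → E}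
    (hh : ContinuousOn h I) {η : ℝ} (hη : 0 < η) :
    ∀ᶠ ε : ℝ in 𝓝[>] 0, ∀ x ∈ I, ∀ z ∈ I, dist z x < ε → dist (h z) (h x) < η := by
  obtain ⟨δ, hδ, hlt⟩ :=
    Metric.uniformContinuousOn_iff.1 (hI.uniformContinuousOn_of_continuous hh) η hη
  filter_upwards [Ioo_mem_nhdsGT hδ] with ε hε x hx z hz hzx
  exact hlt z hz x hx (hzx.trans hε.2)

lemma exists_forall_isReturning {h : Bool → E → E} {I C : Set E} {D O : Bool → Set E}
    (hI : IsCompact I) (hh : ∀ s, ContinuousOn (h s) I) (hC : IsCompact C)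
    (hD : ∀ s, IsCompact (D s)) (hCI : C ⊆ interior I) (hDI : ∀ s, D s ⊆ I)
    (hO : ∀ s, IsOpen (O s)) (hOCD : ∀ s, O s ⊆ C ∪ D s) (hstay : ∀ s, MapsTo (h s) C (O s))
    (hback : ∀ s, MapsTo (h (!s)) (D s) (interior I))
    (hback₂ : ∀ s, MapsTo (h (!s) ∘ h (!s)) (D s) (interior C)) :
    ∃ ε : ℝ, 0 < ε ∧ ∀ g : Bool → Bool → E → E,
      (∀ s, ∀ x ∈ I, dist (g s s x) (h s x) < ε) →
      (∀ s, ∀ x ∈ I, dist (g s (!s) x) x < ε) → ∃ A, IsReturning g I C A := by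
  have hCI' : C ⊆ I := hCI.trans interior_subset
  have hOI : ∀ s, O s ⊆ I := fun s => (hOCD s).trans (union_subset hCI' (hDI s))
  have hback' : ∀ s, MapsTo (h (!s)) (D s) I := fun s x hx => interior_subset (hback s hx)
  have e₁ := eventually_all.2 fun s =>
    (hC.image_of_continuousOn ((hh s).mono hCI')).eventually_forall_dist_lt_mem (hO s)
      (hstay s).image_subset
  have e₂ := hC.eventually_forall_dist_lt_mem isOpen_interior hCI
  have e₃ := eventually_all.2 fun s =>
    ((hD s).image_of_continuousOn ((hh (!s)).mono (hDI s))).eventually_forall_dist_lt_mem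
      isOpen_interior (hback s).image_subset
  have e₄ := eventually_all.2 fun s =>
    ((hD s).image_of_continuousOn ((hh (!s)).comp ((hh (!s)).mono (hDI s))
      (hback' s))).eventually_forall_dist_lt_mem isOpen_interior (hback₂ s).image_subset
  obtain ⟨η, ⟨⟨⟨⟨hη₁, hη₂⟩, hη₃⟩, hη₄⟩, hη⟩⟩ :=
    ((((e₁.and e₂).and e₃).and e₄).and self_mem_nhdsWithin).exists
  replace hη : 0 < η := hη
  have e₅ := eventually_all.2 fun s =>
    hI.eventually_dist_lt_of_continuousOn (hh s) (show 0 < η / 4 by positivity)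
  obtain ⟨θ, hθ, hθ₀, hθη⟩ :=
    (e₅.and (Ioo_mem_nhdsGT (show 0 < η / 4 by positivity))).exists
  have e₆ := eventually_all.2 fun s =>
    hI.eventually_dist_lt_of_continuousOn (hh s) (show 0 < θ / 2 by positivity)
  obtain ⟨ε, hε, hε₀, hεθ⟩ :=
    (e₆.and (Ioo_mem_nhdsGT (show 0 < θ / 2 by positivity))).exists
  refine ⟨ε, hε₀, fun g hg hg' => ⟨fun s => {y | ∃ x ∈ C, dist y (h s x) < η / 2}, hCI', ?_, ?_,
    ?_, ?_⟩⟩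
  · rintro s y ⟨x, hx, hy⟩
    exact hOI s (hη₁ s _ (mem_image_of_mem _ hx) y (by linarith))
  · intro s x hx
    exact ⟨x, hx, by linarith [hg s x (hCI' hx)]⟩
  · intro s x hx
    have hz := hg' s x (hCI' hx)
    have hzI : g s (!s) x ∈ I := interior_subset (hη₂ x hx _ (by linarith))
    refine ⟨hzI, x, hx, ?_⟩
    linarith [hg (!s) _ hzI, hε (!s) x (hCI' hx) _ hzI hz,
      dist_triangle (g (!s) (!s) (g s (!s) x)) (h (!s) (g s (!s) x)) (h (!s) x)]
  · rintro s y ⟨x, hx, hy⟩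
    rcases hOCD s (hη₁ s _ (mem_image_of_mem _ hx) y (by linarith)) with hyC | hyD
    · exact Or.inl hyC
    right
    have hyI := hDI s hyD
    have hz := hg' s y hyI
    have hzI : g s (!s) y ∈ I := by
      refine hOI s (hη₁ s _ (mem_image_of_mem _ hx) _ ?_)
      linarith [dist_triangle (g s (!s) y) y (h s x)]
    have hw : dist (g (!s) (!s) (g s (!s) y)) (h (!s) y) < θ := by
      linarith [hg (!s) _ hzI, hε (!s) y hyI _ hzI hz,
        dist_triangle (g (!s) (!s) (g s (!s) y)) (h (!s) (g s (!s) y)) (h (!s) y)]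
    have hwI : g (!s) (!s) (g s (!s) y) ∈ I :=
      interior_subset (hη₃ s _ (mem_image_of_mem _ hyD) _ (by linarith))
    refine ⟨hzI, hwI, interior_subset (hη₄ s _ (mem_image_of_mem _ hyD) _ ?_)⟩
    have := hθ (!s) _ (hback' s hyD) _ hwI hw
    simp only [Function.comp_apply]
    linarith [hg (!s) _ hwI, dist_triangle (g (!s) (!s) (g (!s) (!s) (g s (!s) y)))
      (h (!s) (g (!s) (!s) (g s (!s) y))) (h (!s) (h (!s) y))]

end Perturbation

lemma avoids_isolated_symbol_iff {u v w : Bool} :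
    (¬(u = false ∧ v = true ∧ w = false) ∧ ¬(u = true ∧ v = false ∧ w = true)) ↔
      u = v ∨ v = w := by
  revert u v w
  decide

open Set in
lemma exists_fixed_point_of_le_of_ge {F : ℝ → ℝ} {u v : ℝ} (huv : u ≤ v)
    (hF : ContinuousOn F (Icc u v)) (hu : F u ≤ u) (hv : v ≤ F v) :
    ∃ y ∈ Icc u v, F y = y := by
  have hc : ContinuousOn (fun y => F y - y) (Icc u v) := hF.sub continuousOn_id
  obtain ⟨y, hy, hy₀⟩ := intermediate_value_Icc huv hc ⟨sub_nonpos.2 hu, sub_nonneg.2 hv⟩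
  exact ⟨y, hy, sub_eq_zero.1 hy₀⟩

/-- Robust positive entropy for perturbed iterated function systems over
the subshift of finite type forbidding the words `121` and `212`.  Here the symbols `1`
and `2` of the alphabet `{1,2}` are encoded by `false` and `true` respectively, so that
`g false false ≈ ψ`, `g true true ≈ ψ⁻¹`, `g false true ≈ id`, `g true false ≈ id` on
`[a,d]`, up to `ε`.  The set `X'` of sequences in the subshift admitting a bi-infinite
orbit in `[a,d]` is a nonempty closed shift-invariant set on which the shift has positive
topological entropy. -/
theorem perturbed_ifs_positive_entropy
    (U : Set ℝ) (hUopen : IsOpen U) (hUconn : U.OrdConnected)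
    (ψ ψinv : ℝ → ℝ)
    (hψcont : ContinuousOn ψ U) (hψinvcont : ContinuousOn ψinv (ψ '' U))
    (hleft : ∀ x ∈ U, ψinv (ψ x) = x) (hright : ∀ y ∈ ψ '' U, ψ (ψinv y) = y)
    (a b c d : ℝ) (hab : a < b) (hbc : b < c) (hcd : c < d)
    (had : Set.Icc a d ⊆ U ∩ ψ '' U)
    (h1 : ∀ x ∈ Set.Icc a b, ψ x ∈ U ∧ ψ (ψ x) ∈ Set.Ioo b c)
    (h2 : ∀ x ∈ Set.Icc b c, ψinv x ∈ Set.Ioo a c)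
    (h3 : ∀ x ∈ Set.Icc c d, ψinv x ∈ ψ '' U ∧ ψinv (ψinv x) ∈ Set.Ioo b c)
    (h4 : ∀ x ∈ Set.Icc b c, ψ x ∈ Set.Ioo b d) :
    ∃ ε : ℝ, 0 < ε ∧
      ∀ (W : Set ℝ), IsOpen W → W.OrdConnected → Set.Icc a d ⊆ W →
      ∀ g : Bool → Bool → ℝ → ℝ,
        (∀ i j, ContinuousOn (g i j) W ∧ Set.InjOn (g i j) W) →
        (∀ x ∈ Set.Icc a d, |g false false x - ψ x| < ε) →
        (∀ x ∈ Set.Icc a d, |g true true x - ψinv x| < ε) →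
        (∀ x ∈ Set.Icc a d, |g false true x - x| < ε) →
        (∀ x ∈ Set.Icc a d, |g true false x - x| < ε) →
        let σ : (ℤ → Bool) → (ℤ → Bool) := fun ν i => ν (i + 1)
        -- `X'`: sequences in which neither `121` nor `212` occurs and which admit a
        -- bi-infinite orbit in `[a,d]`
        let X' : Set (ℤ → Bool) := {ν |
          (∀ i : ℤ, ¬(ν i = false ∧ ν (i + 1) = true ∧ ν (i + 2) = false) ∧
            ¬(ν i = true ∧ ν (i + 1) = false ∧ ν (i + 2) = true)) ∧
          ∃ x : ℤ → ℝ, (∀ i : ℤ, x i ∈ Set.Icc a d) ∧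
            ∀ i : ℤ, x (i + 1) = g (ν i) (ν (i + 1)) (x i)}
        X'.Nonempty ∧ IsClosed X' ∧ σ '' X' = X' ∧ 0 < coverEntropy σ X' := by
  have hUa : ∀ x ∈ Set.Icc a d, x ∈ U := fun x hx => (had hx).1
  have hVa : ∀ x ∈ Set.Icc a d, x ∈ ψ '' U := fun x hx => (had hx).2
  have hψ : ContinuousOn ψ (Set.Icc a d) := hψcont.mono hUa
  have hφ : ContinuousOn ψinv (Set.Icc a d) := hψinvcont.mono hVa
  have hψab : ∀ x ∈ Set.Icc a b, ψ x ∈ Set.Ioo a d := by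
    intro x hx
    have hb := h4 b ⟨le_rfl, hbc.le⟩
    have hc' : ContinuousOn ψ (Set.Icc x b) :=
      hψ.mono (Set.Icc_subset_Icc hx.1 (hbc.le.trans hcd.le))
    constructor
    · by_contra! hle
      obtain ⟨y, hy, hfix⟩ := exists_fixed_point_of_le_of_ge hx.2 hc'
        (hle.trans hx.1) hb.1.le
      have := (h1 y ⟨hx.1.trans hy.1, hy.2⟩).2.1
      rw [hfix, hfix] at this
      exact this.not_ge hy.2
    · by_contra! hle
      obtain ⟨y, hy, hyd⟩ := intermediate_value_Icc' hx.2 hc' ⟨hb.2.le, hle⟩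
      have hd := (h1 y ⟨hx.1.trans hy.1, hy.2⟩).2
      rw [hyd] at hd
      have := (h2 _ (Set.Ioo_subset_Icc_self hd)).2
      rw [hleft d (hUa d ⟨by linarith, le_rfl⟩)] at this
      linarith
  have hφcd : ∀ x ∈ Set.Icc c d, ψinv x ∈ Set.Ioo a d := by
    intro x hx
    have hc := h2 c ⟨hbc.le, le_rfl⟩
    have hc' : ContinuousOn ψinv (Set.Icc c x) :=
      hφ.mono (Set.Icc_subset_Icc (hab.le.trans hbc.le) hx.2)
    constructor
    · by_contra! hle
      obtain ⟨y, hy, hya⟩ := intermediate_value_Icc' hx.1 hc' ⟨hle, hc.1.le⟩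
      have ha := (h3 y ⟨hy.1, hy.2.trans hx.2⟩).2
      rw [hya] at ha
      have := (h4 _ (Set.Ioo_subset_Icc_self ha)).1
      rw [hright a (hVa a ⟨le_rfl, by linarith⟩)] at this
      linarith
    · by_contra! hle
      obtain ⟨y, hy, hfix⟩ := exists_fixed_point_of_le_of_ge hx.1 hc'
        hc.2.le (hx.2.trans hle)
      have := (h3 y ⟨hy.1, hy.2.trans hx.2⟩).2.2
      rw [hfix, hfix] at this
      exact this.not_ge hy.1
  obtain ⟨ε, hε, hret⟩ := exists_forall_isReturning (h := fun s => cond s ψinv ψ)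
    (I := Set.Icc a d) (C := Set.Icc b c) (D := fun s => cond s (Set.Icc a b) (Set.Icc c d))
    (O := fun s => cond s (Set.Ioo a c) (Set.Ioo b d)) isCompact_Icc (by rintro (_ | _) <;> assumption)
    isCompact_Icc (by rintro (_ | _) <;> exact isCompact_Icc)
    (by rw [interior_Icc]; exact Set.Icc_subset_Ioo hab hcd)
    (by
      rintro (_ | _)
      · exact Set.Icc_subset_Icc_left (by linarith)
      · exact Set.Icc_subset_Icc_right (by linarith))
    (by rintro (_ | _) <;> exact isOpen_Ioo)
    (by
      rintro (_ | _) x ⟨hx₁, hx₂⟩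
      · rcases le_total x c with h | h
        exacts [Or.inl ⟨hx₁.le, h⟩, Or.inr ⟨h, hx₂.le⟩]
      · rcases le_total x b with h | h
        exacts [Or.inr ⟨hx₁.le, h⟩, Or.inl ⟨h, hx₂.le⟩])
    (by rintro (_ | _); exacts [h4, h2])
    (by rw [interior_Icc]; rintro (_ | _); exacts [hφcd, hψab])
    (by
      rw [interior_Icc]
      rintro (_ | _)
      exacts [fun x hx => (h3 x hx).2, fun x hx => (h1 x hx).2])
  refine ⟨ε, hε, fun W _ _ hW g hg hg₁₁ hg₂₂ hg₁₂ hg₂₁ => ?_⟩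
  obtain ⟨A, hA⟩ := hret g (by rintro (_ | _); exacts [hg₁₁, hg₂₂])
    (by rintro (_ | _); exacts [hg₁₂, hg₂₁])
  have hgc : ∀ s t, ContinuousOn (g s t) (Set.Icc a d) := fun s t => (hg s t).1.mono hW
  intro σ X'
  have hX' : X' = (fun (p : ℤ → Bool × ℝ) i => (p i).1) ''
      {p | (∀ i, (p i).2 ∈ Set.Icc a d) ∧ ∀ i, IsStep g p i} := by
    ext ν
    constructor
    · rintro ⟨hν, x, hx, hstep⟩
      refine ⟨fun i => (ν i, x i), ⟨hx, fun i => ⟨hstep i, ?_⟩⟩, rfl⟩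
      have := hν (i - 1)
      rw [sub_add_cancel, show i - 1 + 2 = i + 1 by ring] at this
      exact avoids_isolated_symbol_iff.1 this
    · rintro ⟨p, ⟨hp, hstep⟩, rfl⟩
      refine ⟨fun i => ?_, fun i => (p i).2, hp, fun i => (hstep i).1⟩
      have := (hstep (i + 1)).2
      rw [add_sub_cancel_right, add_assoc, one_add_one_eq_two] at this
      exact avoids_isolated_symbol_iff.2 this
  obtain ⟨p, hp, hfree⟩ := hA.exists_past isCompact_Icc hgc (Set.nonempty_Icc.2 hbc.le) isClosed_Icc
  obtain ⟨Φ, hΦ, hsep⟩ := hA.exists_branching hp hfree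
  have hmem : ∀ β, (fun i => (Φ β i).1) ∈ X' := fun β => by
    rw [hX']
    exact ⟨Φ β, ⟨fun i => (hΦ β i).1, fun i => (hΦ β i).2⟩, rfl⟩
  refine ⟨⟨_, hmem fun _ => false⟩, ?_, ?_, coverEntropy_shift_pos_s12 _ hmem hsep⟩
  · rw [hX']
    have hcl : IsClosed {p : ℤ → Bool × ℝ | (∀ i, (p i).2 ∈ Set.Icc a d) ∧ ∀ i, IsStep g p i} := by
      convert isClosed_iInter fun i => isClosed_setOf_isStep (isClosed_Icc (a := a) (b := d)) hgc i
      ext p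
      simp [forall_and]
    exact (((isCompact_setOf_forall_mem isCompact_Icc).of_isClosed_subset hcl
      fun p hp => hp.1).image (continuous_pi fun i =>
        continuous_fst.comp (continuous_apply i))).isClosed
  · apply Set.Subset.antisymm
    · rintro _ ⟨ν, ⟨hν, x, hx, hstep⟩, rfl⟩
      refine ⟨fun i => ?_, fun i => x (i + 1), fun i => hx _, fun i => hstep _⟩
      have := hν (i + 1)
      rwa [add_right_comm i 1 2] at this
    · rintro ν ⟨hν, x, hx, hstep⟩
      refine ⟨fun i => ν (i - 1), ⟨fun i => ?_, fun i => x (i - 1), fun i => hx _, fun i => ?_⟩,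
        funext fun i => ?_⟩
      · have := hν (i - 1)
        rwa [sub_add_eq_add_sub, sub_add_eq_add_sub] at this
      · have := hstep (i - 1)
        rwa [sub_add_eq_add_sub] at this
      · simp [σ]
end
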